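/- arXiv:2101.01146 — 4 statements merged into one kernel-verified Lean document; each statement's English description precedes it below -/
import Mathlib

section
/- There are universal constants c > 0 and c' > 0 such that for every integer k ≥ 1 there is N ∈ ℕ so that for every n ≥ N there exists a metric space (X, d_X) on n points with the following property: every clan embedding (f, χ) of (X, d_X) into a tree metric with multiplicative distortion at most c·k satisfies Σ_{x∈X}|f(x)| ≥ c'·n^{1+1/k}. -/
/-- A dominating one-to-many embedding: each point has a nonempty clan, clans are
pairwise disjoint, and distances between copies dominate the original distances. -/
def IsDominatingOneToMany (X Y : Type*) [iX : MetricSpace X] [iY : MetricSpace Y]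
    (f : X → Finset Y) : Prop :=
  (∀ x, (f x).Nonempty) ∧
  (∀ x y : X, x ≠ y → Disjoint (f x) (f y)) ∧
  (∀ x y : X, x ≠ y → ∀ x' ∈ f x, ∀ y' ∈ f y, dist x y ≤ dist x' y')

/-- A clan embedding `(f, χ)` with multiplicative distortion `t`. -/
def IsClanEmbedding (X Y : Type*) [iX : MetricSpace X] [iY : MetricSpace Y]
    (f : X → Finset Y) (χ : X → Y) (t : ℝ) : Prop :=
  IsDominatingOneToMany X Y f ∧
  (∀ x, χ x ∈ f x) ∧
  (∀ x y : X, ∃ y' ∈ f y, dist y' (χ x) ≤ t * dist x y)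

/-- `(Y, dist)` is a tree metric: there is a tree on vertex set `Y` with positive edge
weights whose path-weight distance is `dist`. -/
def IsTreeMetric (Y : Type*) [iY : MetricSpace Y] : Prop :=
  ∃ (T : SimpleGraph Y) (w : Sym2 Y → ℝ),
    T.IsTree ∧ (∀ e ∈ T.edgeSet, 0 < w e) ∧
    ∀ (u v : Y) (p : T.Walk u v), p.IsPath → dist u v = (p.edges.map w).sum

theorem zmod_two_aux (q : ZMod 2) : 1 + q + 1 = 0 + q := by
  revert q; decide

theorem zmod_two_aux3 : ∀ q1 q2 q3 : ZMod 2, q1 + q2 + q3 = 0 → q1 + q2 = q3 := by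
  decide

theorem append_isPath_aux {V : Type*} {T : SimpleGraph V} {u v w : V} (p : T.Walk u v)
    (q : T.Walk v w) (hp : p.IsPath) (hq : q.IsPath)
    (h : ∀ x ∈ p.support, x ∈ q.support → x = v) : (p.append q).IsPath := by
  induction p with
  | nil => simpa using hq
  | cons hadj p ih =>
    rw [SimpleGraph.Walk.cons_append, SimpleGraph.Walk.cons_isPath_iff]
    rw [SimpleGraph.Walk.cons_isPath_iff] at hp
    refine ⟨ih q hp.1 hq (fun x hx hx' => h x (by simp [hx]) hx'), ?_⟩
    rw [SimpleGraph.Walk.mem_support_append_iff]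
    rintro (h1 | h1)
    · exact hp.2 h1
    · have := h _ (by simp) h1
      subst this
      exact hp.2 (by simp)

theorem between_aux {Y : Type*} [MetricSpace Y] {T : SimpleGraph Y} {w : Sym2 Y → ℝ}
    (hd : ∀ (u v : Y) (p : T.Walk u v), p.IsPath → dist u v = (p.edges.map w).sum)
    {a b m : Y} (p : T.Walk a b) (hp : p.IsPath) (hm : m ∈ p.support) :
    dist a b = dist a m + dist m b := by
  classical
  rw [hd a b p hp, hd a m _ (hp.takeUntil hm), hd m b _ (hp.dropUntil hm), ← List.sum_append,
    ← List.map_append, ← SimpleGraph.Walk.edges_append, SimpleGraph.Walk.take_spec]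

theorem project_aux {Y : Type*} [MetricSpace Y] {T : SimpleGraph Y} {w : Sym2 Y → ℝ}
    (hT : T.IsTree)
    (hd : ∀ (u v : Y) (p : T.Walk u v), p.IsPath → dist u v = (p.edges.map w).sum)
    {a b : Y} (p : T.Walk a b) (hp : p.IsPath) (z : Y) :
    ∃ m ∈ p.support, dist z a = dist z m + dist m a ∧ dist z b = dist z m + dist m b := by
  classical
  obtain ⟨m, hm, hmin⟩ := Finset.exists_min_image p.support.toFinset (fun m => dist z m)
    ⟨a, by simp⟩
  rw [List.mem_toFinset] at hm
  refine ⟨m, hm, ?_⟩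
  obtain ⟨q, hq, -⟩ := hT.existsUnique_path z m
  have key : ∀ x ∈ q.support, x ∈ p.support → x = m := by
    intro x hx hx'
    have h1 := hmin x (by simpa using hx')
    have h2 := between_aux hd q hq hx
    have : dist x m ≤ 0 := by linarith
    exact dist_le_zero.1 this
  constructor
  · have := append_isPath_aux q (p.takeUntil m hm).reverse hq (hp.takeUntil hm).reverse
      (fun x hx hx' => key x hx (p.support_takeUntil_subset_support hm (by simpa using hx')))
    exact between_aux hd _ this (by simp [SimpleGraph.Walk.mem_support_append_iff])
  · have := append_isPath_aux q (p.dropUntil m hm) hq (hp.dropUntil hm)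
      (fun x hx hx' => key x hx (p.support_dropUntil_subset_support hm hx'))
    exact between_aux hd _ this (by simp [SimpleGraph.Walk.mem_support_append_iff])

/-- four point condition -/
theorem fourPoint_aux {Y : Type*} [MetricSpace Y] (hY : IsTreeMetric Y) (u r a b : Y) :
    dist u r + dist a b ≤ max (dist u a + dist r b) (dist u b + dist r a) := by
  classical
  obtain ⟨T, w, hT, -, hd⟩ := hY
  obtain ⟨p, hp, -⟩ := hT.existsUnique_path a b
  obtain ⟨m, hm, hm1, hm2⟩ := project_aux hT hd p hp u
  obtain ⟨m', hm', hm1', hm2'⟩ := project_aux hT hd p hp r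
  have h1 := between_aux hd p hp hm
  have h2 := between_aux hd p hp hm'
  have h3 : dist u r ≤ dist u m + dist m m' + dist r m' := by
    have e1 := dist_triangle u m r
    have e2 := dist_triangle m m' r
    rw [dist_comm m' r] at e2
    linarith
  have hspec := p.take_spec hm
  have hm'' : m' ∈ (p.takeUntil m hm).support ∨ m' ∈ (p.dropUntil m hm).support := by
    rw [← SimpleGraph.Walk.mem_support_append_iff, hspec]; exact hm'
  rw [dist_comm a m] at h1
  rw [dist_comm a m'] at h2
  rcases hm'' with h | h
  · have h4 := between_aux hd _ (hp.takeUntil hm) h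
    rw [dist_comm a m, dist_comm a m', dist_comm m' m] at h4
    apply le_max_of_le_left
    linarith
  · have h4 := between_aux hd _ (hp.dropUntil hm) h
    apply le_max_of_le_right
    linarith

/-- cocycles on the threshold graph of a `0`-hyperbolic space are exact -/
theorem exact_aux {I W : Type*} [AddCommGroup W] (D : I → I → ℝ) (t : ℝ) (φ : I → I → W)
    (ht : 0 ≤ t) (hself : ∀ u, D u u = 0) (hsymm : ∀ u v, D u v = D v u)
    (h4 : ∀ u r a b, D u r + D a b ≤ max (D u a + D r b) (D u b + D r a))
    (hφ : ∀ u v w, D u v ≤ t → D v w ≤ t → D u w ≤ t → φ u v + φ v w = φ u w)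
    (r : I) (S : Finset I) :
    ∃ ψ : I → W, ∀ u ∈ S, ∀ v ∈ S, D u v ≤ t → φ u v = ψ v - ψ u := by
  classical
  have h0 : ∀ u, φ u u = 0 := by
    intro u
    have := hφ u u u (by rw [hself]; exact ht) (by rw [hself]; exact ht) (by rw [hself]; exact ht)
    simpa using this
  have hanti : ∀ u v, D u v ≤ t → φ v u = - φ u v := by
    intro u v h
    have := hφ u v u h (by rw [hsymm]; exact h) (by rw [hself]; exact ht)
    rw [h0] at this
    exact (neg_eq_of_add_eq_zero_right this).symm
  induction S using Finset.induction_on_max_value (fun y => D r y) with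
  | empty => exact ⟨0, by simp⟩
  | insert a S haS hmax ih =>
    obtain ⟨ψ, hψ⟩ := ih
    have hcl : ∀ x ∈ S, ∀ y ∈ S, D x a ≤ t → D y a ≤ t → D x y ≤ t := by
      intro x hx y hy hxa hya
      have e := h4 a r x y
      have e1 := hmax x hx
      have e2 := hmax y hy
      rw [hsymm a r, hsymm a x, hsymm a y] at e
      rcases le_max_iff.1 e with e | e <;> linarith
    by_cases hn : ∃ b ∈ S, D b a ≤ t
    · obtain ⟨b, hb, hba⟩ := hn
      have key : ∀ x ∈ S, D x a ≤ t → φ x a = (ψ b + φ b a) - ψ x := by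
        intro x hx hxa
        have hxb := hcl x hx b hb hxa hba
        rw [← hφ x b a hxb hba hxa, hψ x hx b hb hxb]
        abel
      refine ⟨Function.update ψ a (ψ b + φ b a), ?_⟩
      intro u hu v hv huv
      rcases Finset.mem_insert.1 hu with rfl | hu' <;> rcases Finset.mem_insert.1 hv with rfl | hv'
      · simp [h0]
      · have hne : v ≠ u := fun h => haS (h ▸ hv')
        rw [hsymm] at huv
        rw [hanti v u huv, key v hv' huv]
        simp [hne]
      · have hne : u ≠ v := fun h => haS (h ▸ hu')
        rw [key u hu' huv]
        simp [hne]
      · have hne : u ≠ a := fun h => haS (h ▸ hu')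
        have hne' : v ≠ a := fun h => haS (h ▸ hv')
        simp [hne, hne', hψ u hu' v hv' huv]
    · push Not at hn
      refine ⟨ψ, ?_⟩
      intro u hu v hv huv
      rcases Finset.mem_insert.1 hu with rfl | hu' <;> rcases Finset.mem_insert.1 hv with rfl | hv'
      · simp [h0]
      · rw [hsymm] at huv
        exact absurd huv (not_le.2 (hn v hv'))
      · exact absurd huv (not_le.2 (hn u hu'))
      · exact hψ u hu' v hv' huv

open Classical in
theorem count_bridge_aux {V : Type*} {G : SimpleGraph V} {a b : V}
    (hadj : G.Adj a b) (hb : G.IsBridge s(a, b)) {u v : V} (p : G.Walk u v) :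
    (p.edges.count s(a, b) : ZMod 2) =
      (if (G.deleteEdges {s(a, b)}).Reachable a u then 1 else 0) +
      (if (G.deleteEdges {s(a, b)}).Reachable a v then 1 else 0) := by
  induction p with
  | nil => simp; split_ifs <;> decide
  | @cons x y z h p ih =>
    rw [SimpleGraph.isBridge_iff] at hb
    rw [SimpleGraph.Walk.edges_cons, List.count_cons]
    push_cast
    rw [ih]
    by_cases he : s(x, y) = s(a, b)
    · rcases Sym2.eq_iff.1 he with ⟨rfl, rfl⟩ | ⟨rfl, rfl⟩
      · simp [hb]
        ring
      · have hs : s(x, y) = s(y, x) := Sym2.eq_swap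
        simp only [hs, hb, SimpleGraph.Reachable.refl, if_true, if_false, beq_self_eq_true]
        push_cast
        rw [zmod_two_aux]
    · have hd : (G.deleteEdges {s(a, b)}).Adj x y := by
        simp [SimpleGraph.deleteEdges_adj, h, he]
      have : (G.deleteEdges {s(a, b)}).Reachable a x ↔ (G.deleteEdges {s(a, b)}).Reachable a y :=
        ⟨fun k => k.trans hd.reachable, fun k => k.trans hd.symm.reachable⟩
      simp [he, this]

open Classical in
/-- short closed walks in a graph of large girth traverse every edge an even number of times -/
theorem even_closed_aux {V : Type*} {G : SimpleGraph V} {g : ℕ}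
    (hG : ∀ (v : V) (c : G.Walk v v), c.IsCycle → g < c.length) {u : V} (p : G.Walk u u)
    (hp : p.length ≤ g) (e : Sym2 V) : (p.edges.count e : ZMod 2) = 0 := by
  by_cases he : e ∈ p.edges
  swap
  · rw [List.count_eq_zero_of_not_mem he]; simp
  set G' : SimpleGraph V := SimpleGraph.fromEdgeSet {e | e ∈ p.edges} with hG'
  have hedge : ∀ e ∈ p.edges, e ∈ G'.edgeSet := by
    intro e he
    rw [hG', SimpleGraph.edgeSet_fromEdgeSet]
    exact ⟨he, G.not_isDiag_of_mem_edgeSet (p.edges_subset_edgeSet he)⟩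
  have hsub : ∀ e ∈ G'.edgeSet, e ∈ p.edges := by
    intro e he
    rw [hG', SimpleGraph.edgeSet_fromEdgeSet] at he
    exact he.1
  have hac : G'.IsAcyclic := by
    intro v c hc
    have hc' : ∀ e ∈ c.edges, e ∈ p.edges := fun e he => hsub e (c.edges_subset_edgeSet he)
    have hc2 : ∀ e ∈ c.edges, e ∈ G.edgeSet := fun e he => p.edges_subset_edgeSet (hc' e he)
    have h1 := hG v (c.transfer G hc2) (hc.transfer hc2)
    rw [SimpleGraph.Walk.length_transfer] at h1
    have h2 : c.edges.length ≤ p.edges.length :=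
      (List.subperm_of_subset hc.edges_nodup hc').length_le
    simp only [SimpleGraph.Walk.length_edges] at h2
    omega
  have hbr := SimpleGraph.isAcyclic_iff_forall_isBridge.1 hac (hedge e he)
  induction e with | _ a b =>
  have := count_bridge_aux (hedge _ he) hbr (p.transfer G' hedge)
  rw [SimpleGraph.Walk.edges_transfer] at this
  rw [this]
  split_ifs <;> decide

open Classical in
theorem key_aux {X Y : Type} [MetricSpace X] [Fintype X] [MetricSpace Y]
    (G : SimpleGraph X) (g : ℕ) (t : ℝ) (ht : 0 ≤ t) (htg : 3 * t ≤ g)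
    (hG : ∀ (v : X) (c : G.Walk v v), c.IsCycle → g < c.length)
    (hadj : ∀ x y, G.Adj x y → dist x y = 1)
    (hwalk : ∀ x y, dist x y ≤ t → ∃ p : G.Walk x y, (p.length : ℝ) ≤ dist x y)
    (f : X → Finset Y) (χ : X → Y) (hY : IsTreeMetric Y)
    (hf : IsClanEmbedding X Y f χ t) :
    Fintype.card G.edgeSet ≤ ∑ x, (f x).card := by
  obtain ⟨⟨-, -, hdom⟩, hχ, hdist⟩ := hf
  let I := Σ x : X, {y // y ∈ f x}
  have hI : Fintype.card I = ∑ x, (f x).card := by simp [I]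
  rw [← hI]
  rcases isEmpty_or_nonempty I with hemp | ⟨⟨r⟩⟩
  · have : IsEmpty X := ⟨fun x => hemp.false ⟨x, χ x, hχ x⟩⟩
    have : IsEmpty G.edgeSet := ⟨fun e => by
      obtain ⟨e, he⟩ := e
      induction e with | _ a b => exact this.false a⟩
    simp
  let D : I → I → ℝ := fun u v => dist (u.2 : Y) (v.2 : Y)
  have hLip : ∀ u v : I, dist u.1 v.1 ≤ D u v := by
    intro u v
    by_cases h : u.1 = v.1
    · rw [h, dist_self]; exact dist_nonneg
    · exact hdom _ _ h _ u.2.2 _ v.2.2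
  let F : ∀ x y : X, G.edgeSet → ZMod 2 := fun x y e =>
    if h : dist x y ≤ t then ((hwalk x y h).choose.edges.count (e : Sym2 X) : ZMod 2) else 0
  let φ : I → I → (G.edgeSet → ZMod 2) := fun u v => F u.1 v.1
  obtain ⟨ψ, hψ⟩ := exact_aux D t φ ht (fun u => dist_self _) (fun u v => dist_comm _ _)
    (fun u r a b => fourPoint_aux hY _ _ _ _) (by
      intro u v w h1 h2 h3
      have k1 := (hLip u v).trans h1
      have k2 := (hLip v w).trans h2
      have k3 := (hLip u w).trans h3
      funext e
      simp only [φ, F, Pi.add_apply, dif_pos k1, dif_pos k2, dif_pos k3]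
      have l1 := (hwalk _ _ k1).choose_spec
      have l2 := (hwalk _ _ k2).choose_spec
      have l3 := (hwalk _ _ k3).choose_spec
      generalize (hwalk _ _ k1).choose = p1 at *
      generalize (hwalk _ _ k2).choose = p2 at *
      generalize (hwalk _ _ k3).choose = p3 at *
      have hl : ((p1.append p2).append p3.reverse).length ≤ g := by
        simp only [SimpleGraph.Walk.length_append, SimpleGraph.Walk.length_reverse]
        have : ((p1.length + p2.length + p3.length : ℕ) : ℝ) ≤ g := by push_cast; linarith
        exact_mod_cast this
      have := even_closed_aux hG _ hl e
      simp only [SimpleGraph.Walk.edges_append, SimpleGraph.Walk.edges_reverse, List.count_append,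
        List.count_reverse] at this
      push_cast at this
      generalize (List.count _ p1.edges : ZMod 2) = q1 at *
      generalize (List.count _ p2.edges : ZMod 2) = q2 at *
      generalize (List.count _ p3.edges : ZMod 2) = q3 at *
      exact zmod_two_aux3 _ _ _ this) r Finset.univ
  have hspan : (⊤ : Submodule (ZMod 2) (G.edgeSet → ZMod 2)) ≤
      Submodule.span (ZMod 2) (Set.range ψ) := by
    rw [← (Pi.basisFun (ZMod 2) G.edgeSet).span_eq, Submodule.span_le]
    rintro _ ⟨⟨e, he⟩, rfl⟩
    induction e with | _ x y =>
    have hxy : G.Adj x y := he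
    obtain ⟨y', hy', hd⟩ := hdist x y
    rw [hadj x y hxy, mul_one, dist_comm] at hd
    have e1 := hψ ⟨x, χ x, hχ x⟩ (Finset.mem_univ _) ⟨y, y', hy'⟩ (Finset.mem_univ _) hd
    have e2 : φ ⟨x, χ x, hχ x⟩ ⟨y, y', hy'⟩ = Pi.basisFun (ZMod 2) G.edgeSet ⟨s(x, y), he⟩ := by
      have k1 := (hLip ⟨x, χ x, hχ x⟩ ⟨y, y', hy'⟩).trans hd
      funext e
      simp only [φ, F, dif_pos k1]
      have l1 := (hwalk _ _ k1).choose_spec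
      generalize (hwalk _ _ k1).choose = p1 at *
      simp only [hadj x y hxy] at l1
      have l2 : p1.length ≤ 1 := by exact_mod_cast l1
      cases p1 with
      | nil => exact absurd hxy (G.irrefl)
      | cons h q =>
        cases q with
        | nil =>
          obtain ⟨e, he'⟩ := e
          by_cases hee : e = s(x, y)
          · subst hee; simp
          · have hee' : ¬ s(x, y) = e := fun h => hee h.symm
            simp [Pi.single_apply, List.count_cons, hee, hee']
        | cons h q => simp at l2
    rw [SetLike.mem_coe, ← e2, e1]
    exact Submodule.sub_mem _ (Submodule.subset_span ⟨_, rfl⟩) (Submodule.subset_span ⟨_, rfl⟩)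
  have h1 := finrank_range_le_card (R := ZMod 2) ψ
  rw [Set.finrank, top_le_iff.1 hspan, finrank_top, Module.finrank_fintype_fun_eq_card] at h1
  exact h1

theorem split_edge_aux {V : Type*} {G : SimpleGraph V} {v w : V} {a b : V}
    (p : (G ⊔ SimpleGraph.edge v w).Walk a b) (hp : p.IsTrail) (he : s(v, w) ∈ p.edges) :
    (∃ (q : G.Walk a v) (r : G.Walk w b), q.length + r.length + 1 = p.length) ∨
    (∃ (q : G.Walk a w) (r : G.Walk v b), q.length + r.length + 1 = p.length) := by
  have hmem : ∀ e ∈ (G ⊔ SimpleGraph.edge v w).edgeSet, e ≠ s(v, w) → e ∈ G.edgeSet := by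
    intro e he hne
    induction e with | _ x y =>
    have he : (G ⊔ SimpleGraph.edge v w).Adj x y := he
    rw [SimpleGraph.sup_adj] at he
    rcases he with he | he
    · exact he
    · exact absurd ((SimpleGraph.adj_edge _ _).1 he).1.symm hne
  induction p with
  | nil => simp at he
  | @cons x y z h p ih =>
    rw [SimpleGraph.Walk.isTrail_cons] at hp
    by_cases hxy : s(x, y) = s(v, w)
    · have hp' : ∀ e ∈ p.edges, e ∈ G.edgeSet := fun e he =>
        hmem e (p.edges_subset_edgeSet he) (fun h => hp.2 (by rw [hxy, ← h]; exact he))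
      rcases Sym2.eq_iff.1 hxy with ⟨rfl, rfl⟩ | ⟨rfl, rfl⟩
      · exact Or.inl ⟨.nil, p.transfer G hp', by simp⟩
      · exact Or.inr ⟨.nil, p.transfer G hp', by simp⟩
    · have he' : s(v, w) ∈ p.edges := by
        rw [SimpleGraph.Walk.edges_cons, List.mem_cons] at he
        exact he.resolve_left (fun h => hxy h.symm)
      have hG : G.Adj x y := hmem _ h hxy
      rcases ih hp.1 he' with ⟨q, r, hqr⟩ | ⟨q, r, hqr⟩
      · exact Or.inl ⟨.cons hG q, r, by simp; omega⟩
      · exact Or.inr ⟨.cons hG q, r, by simp; omega⟩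

open Classical in
theorem ball_card_aux {V : Type*} [Fintype V] (G : SimpleGraph V) (Δ : ℕ)
    (hdeg : ∀ v, G.degree v ≤ Δ) (v : V) (k : ℕ) :
    (Finset.univ.filter (fun w => ∃ p : G.Walk w v, p.length ≤ k)).card ≤ (Δ + 1) ^ k := by
  induction k with
  | zero =>
    have : (Finset.univ.filter (fun w => ∃ p : G.Walk w v, p.length ≤ 0)) ⊆ {v} := by
      intro w hw
      obtain ⟨p, hp⟩ := (Finset.mem_filter.1 hw).2
      simpa using SimpleGraph.Walk.eq_of_length_eq_zero (Nat.le_zero.1 hp)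
    simpa using Finset.card_le_card this
  | succ k ih =>
    have hsub : (Finset.univ.filter (fun w => ∃ p : G.Walk w v, p.length ≤ k + 1)) ⊆
        (Finset.univ.filter (fun w => ∃ p : G.Walk w v, p.length ≤ k)).biUnion
          (fun w => insert w (G.neighborFinset w)) := by
      intro w hw
      obtain ⟨p, hp⟩ := (Finset.mem_filter.1 hw).2
      rw [Finset.mem_biUnion]
      cases p with
      | nil => exact ⟨v, by simpa using ⟨.nil, by simp⟩, by simp⟩
      | @cons _ y _ h q =>
        refine ⟨y, ?_, ?_⟩
        · simp only [Finset.mem_filter, Finset.mem_univ, true_and]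
          exact ⟨q, by simpa using hp⟩
        · simp [h.symm]
    calc _ ≤ _ := Finset.card_le_card hsub
      _ ≤ (Finset.univ.filter (fun w => ∃ p : G.Walk w v, p.length ≤ k)).card * (Δ + 1) := by
        apply Finset.card_biUnion_le_card_mul
        intro w _
        refine (Finset.card_insert_le _ _).trans ?_
        have := hdeg w
        rw [← SimpleGraph.card_neighborFinset_eq_degree] at this
        omega
      _ ≤ _ := by rw [pow_succ]; exact Nat.mul_le_mul_right _ ih

open Classical in
theorem graph_aux (n Δ k : ℕ) (hk : 1 ≤ k) (h : 2 * (Δ + 1) ^ k ≤ n) :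
    ∃ G : SimpleGraph (Fin n), (∀ (v : Fin n) (c : G.Walk v v), c.IsCycle → k + 1 < c.length) ∧
      Δ * n ≤ 4 * Fintype.card G.edgeSet := by
  let P : SimpleGraph (Fin n) → Prop := fun G =>
    (∀ (v : Fin n) (c : G.Walk v v), c.IsCycle → k + 1 < c.length) ∧ ∀ v, G.degree v ≤ Δ
  have hbot : P ⊥ := by
    refine ⟨fun v c hc => ?_, fun v => by simp⟩
    exact absurd hc (SimpleGraph.isAcyclic_bot c)
  obtain ⟨G, hG, hmax⟩ := Finset.exists_max_image (Finset.univ.filter P)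
    (fun G => Fintype.card G.edgeSet) ⟨⊥, by simp [hbot]⟩
  have hP : P G := (Finset.mem_filter.1 hG).2
  refine ⟨G, hP.1, ?_⟩
  set S := Finset.univ.filter (fun v => G.degree v < Δ) with hS
  have hclose : ∀ v ∈ S, ∀ w ∈ S, ∃ p : G.Walk w v, p.length ≤ k := by
    intro v hv w hw
    by_contra hno
    push Not at hno
    have hvw : v ≠ w := by
      rintro rfl
      exact absurd (hno .nil) (by simp)
    have hnadj : ¬ G.Adj v w := by
      intro hadj
      have := hno (.cons hadj.symm .nil)
      simp at this
      omega
    obtain ⟨H, hH⟩ : ∃ H, H = G ⊔ SimpleGraph.edge v w := ⟨_, rfl⟩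
    have hHadj : ∀ x y, H.Adj x y ↔ G.Adj x y ∨ (SimpleGraph.edge v w).Adj x y := by
      intro x y
      rw [hH, SimpleGraph.sup_adj]
    have hP' : P H := by
      constructor
      · subst hH
        intro x c hc
        by_cases he : s(v, w) ∈ c.edges
        · rcases split_edge_aux c hc.isTrail he with ⟨q, r, hqr⟩ | ⟨q, r, hqr⟩
          · have := hno (r.append q)
            simp at this
            omega
          · have := hno (r.append q).reverse
            simp at this
            omega
        · have hc2 : ∀ e ∈ c.edges, e ∈ G.edgeSet := by
            intro e hee
            have h1 := c.edges_subset_edgeSet hee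
            have hne : e ≠ s(v, w) := fun h => he (h ▸ hee)
            induction e with | _ a b =>
            have h1 : (G ⊔ SimpleGraph.edge v w).Adj a b := h1
            rw [SimpleGraph.sup_adj] at h1
            rcases h1 with h1 | h1
            · exact h1
            · exact absurd ((SimpleGraph.adj_edge _ _).1 h1).1.symm hne
          have := hP.1 x (c.transfer G hc2) (hc.transfer hc2)
          simpa using this
      · intro x
        have hv' : G.degree v < Δ := (Finset.mem_filter.1 hv).2
        have hw' : G.degree w < Δ := (Finset.mem_filter.1 hw).2
        have hx := hP.2 x
        rw [← SimpleGraph.card_neighborFinset_eq_degree] at hv' hw' hx ⊢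
        by_cases hxv : x = v
        · subst hxv
          have : H.neighborFinset x ⊆ insert w (G.neighborFinset x) := by
            intro y
            simp only [SimpleGraph.mem_neighborFinset, hHadj, SimpleGraph.edge_adj,
              Finset.mem_insert]
            grind
          have h1 := Finset.card_le_card this
          have h2 := Finset.card_insert_le w (G.neighborFinset x)
          omega
        by_cases hxw : x = w
        · subst hxw
          have : H.neighborFinset x ⊆ insert v (G.neighborFinset x) := by
            intro y
            simp only [SimpleGraph.mem_neighborFinset, hHadj, SimpleGraph.edge_adj,
              Finset.mem_insert]
            grind
          have h1 := Finset.card_le_card this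
          have h2 := Finset.card_insert_le v (G.neighborFinset x)
          omega
        · have : H.neighborFinset x ⊆ G.neighborFinset x := by
            intro y
            simp only [SimpleGraph.mem_neighborFinset, hHadj, SimpleGraph.edge_adj]
            grind
          exact (Finset.card_le_card this).trans hx
    have h1 := hmax _ (Finset.mem_filter.2 ⟨Finset.mem_univ _, hP'⟩)
    have h2 : Fintype.card G.edgeSet < Fintype.card H.edgeSet := by
      apply Set.card_lt_card
      rw [SimpleGraph.edgeSet_ssubset_edgeSet]
      refine lt_of_le_of_ne (hH ▸ le_sup_left) (fun h => hnadj ?_)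
      rw [h, hHadj]
      simp [SimpleGraph.edge_adj, hvw]
    omega
  have hScard : S.card ≤ (Δ + 1) ^ k := by
    rcases S.eq_empty_or_nonempty with h0 | ⟨v, hv⟩
    · simp [h0]
    · refine le_trans (Finset.card_le_card ?_) (ball_card_aux G Δ hP.2 v k)
      intro w hw
      simpa using hclose v hv w hw
  have hsum := G.sum_degrees_eq_twice_card_edges
  have hlow : (Finset.univ \ S).card * Δ ≤ ∑ v, G.degree v := by
    rw [← smul_eq_mul]
    refine (Finset.card_nsmul_le_sum (Finset.univ \ S) (fun v => G.degree v) Δ ?_).trans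
      (Finset.sum_le_sum_of_subset (Finset.subset_univ _))
    intro v hv
    simpa [hS] using hv
  have hc : (Finset.univ \ S).card + S.card = n := by
    rw [Finset.card_sdiff_add_card_eq_card (Finset.subset_univ S)]; simp
  have hcard : G.edgeFinset.card = Fintype.card G.edgeSet := by
    rw [SimpleGraph.edgeFinset, Set.toFinset_card]
  rw [hsum, hcard] at hlow
  have : n ≤ 2 * (Finset.univ \ S).card := by omega
  calc Δ * n ≤ Δ * (2 * (Finset.univ \ S).card) := Nat.mul_le_mul_left _ this
    _ = 2 * ((Finset.univ \ S).card * Δ) := by ring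
    _ ≤ _ := by omega

open Classical in
theorem metric_aux {V : Type} (G : SimpleGraph V) (k : ℕ) :
    ∃ m : MetricSpace V, (∀ x y, G.Adj x y → m.dist x y = 1) ∧
      ∀ x y, m.dist x y ≤ k → ∃ p : G.Walk x y, (p.length : ℝ) ≤ m.dist x y := by
  let d : V → V → ℕ := fun x y => (min (G.edist x y) ((k + 1 : ℕ) : ℕ∞)).toNat
  have hd : ∀ x y, (d x y : ℕ∞) = min (G.edist x y) ((k + 1 : ℕ) : ℕ∞) := by
    intro x y
    refine ENat.natCast_toNat (ne_of_lt (lt_of_le_of_lt (min_le_right _ _) (ENat.natCast_lt_top _)))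
  have htri : ∀ x y z, d x z ≤ d x y + d y z := by
    intro x y z
    have : (d x z : ℕ∞) ≤ d x y + d y z := by
      rw [hd, hd, hd]
      rcases le_total (G.edist x y) ((k + 1 : ℕ) : ℕ∞) with h1 | h1
      · rcases le_total (G.edist y z) ((k + 1 : ℕ) : ℕ∞) with h2 | h2
        · rw [min_eq_left h1, min_eq_left h2]
          exact (min_le_left _ _).trans G.edist_triangle
        · rw [min_eq_right h2]
          exact (min_le_right _ _).trans le_add_self
      · rw [min_eq_right h1]
        exact (min_le_right _ _).trans le_self_add
    exact_mod_cast this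
  have hself : ∀ x, d x x = 0 := by
    intro x
    simp [d]
  have hcomm : ∀ x y, d x y = d y x := by
    intro x y
    simp [d, SimpleGraph.edist_comm]
  have hzero : ∀ x y, d x y = 0 → x = y := by
    intro x y h1
    have h2 := hd x y
    rw [h1] at h2
    have h3 : G.edist x y = 0 := by
      rcases min_choice (G.edist x y) ((k + 1 : ℕ) : ℕ∞) with h | h
      · rw [h] at h2; exact h2.symm
      · rw [h] at h2
        have : 0 = k + 1 := by exact_mod_cast h2
        omega
    exact SimpleGraph.edist_eq_zero_iff.1 h3
  let m : MetricSpace V :=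
    { dist := fun x y => (d x y : ℝ)
      dist_self := fun x => by exact_mod_cast hself x
      dist_comm := fun x y => by exact_mod_cast hcomm x y
      dist_triangle := fun x y z => by exact_mod_cast htri x y z
      eq_of_dist_eq_zero := fun {x y} h => hzero x y (by exact_mod_cast h) }
  refine ⟨m, ?_, ?_⟩
  · intro x y h
    change ((d x y : ℕ) : ℝ) = 1
    have : d x y = 1 := by
      have h2 := hd x y
      rw [SimpleGraph.edist_eq_one_iff_adj.2 h, min_eq_left] at h2
      · exact_mod_cast h2
      · exact_mod_cast Nat.le_add_left 1 k
    exact_mod_cast this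
  · intro x y h
    have h1 : d x y ≤ k := by
      have : ((d x y : ℕ) : ℝ) ≤ k := h
      exact_mod_cast this
    have h2 := hd x y
    have h3 : G.edist x y = (d x y : ℕ) := by
      rcases min_choice (G.edist x y) ((k + 1 : ℕ) : ℕ∞) with h | h
      · rw [h] at h2; exact h2.symm
      · rw [h] at h2
        have : d x y = k + 1 := by exact_mod_cast h2
        omega
    obtain ⟨p, hp⟩ := SimpleGraph.exists_walk_of_edist_eq_coe h3
    refine ⟨p, ?_⟩
    change (p.length : ℝ) ≤ ((d x y : ℕ) : ℝ)
    rw [hp]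

/-- lower bound. There is some metric space on `n` points for which every
clan embedding into a (finite) tree metric with multiplicative distortion `c·k` must have
total clan size at least `c'·n^{1+1/k}`. -/
theorem clan_embedding_tree_lower_bound_k :
    ∃ c c' : ℝ, 0 < c ∧ 0 < c' ∧
      ∀ k : ℕ, 1 ≤ k →
      ∃ N : ℕ, ∀ n : ℕ, N ≤ n →
      ∃ (X : Type) (_ : MetricSpace X) (_ : Fintype X), Fintype.card X = n ∧
        ∀ (Y : Type) [MetricSpace Y] [Fintype Y]
          (f : X → Finset Y) (χ : X → Y),
          IsTreeMetric Y →
          IsClanEmbedding X Y f χ (c * (k : ℝ)) →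
          c' * (n : ℝ) ^ (1 + 1 / (k : ℝ)) ≤ ∑ x, ((f x).card : ℝ) := by
  classical
  refine ⟨1 / 3, 1 / 16, by norm_num, by norm_num, fun k hk => ⟨8 ^ k, fun n hn => ?_⟩⟩
  have hk0 : (k : ℝ) ≠ 0 := by positivity
  have hn1 : 1 ≤ n := le_trans (Nat.one_le_pow _ _ (by norm_num)) hn
  have hnpos : (0 : ℝ) < n := by exact_mod_cast hn1
  set s : ℝ := (n : ℝ) ^ (1 / (k : ℝ)) with hs
  have hs0 : 0 ≤ s := by positivity
  have hsk : s ^ k = n := by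
    rw [hs, one_div]
    exact Real.rpow_inv_natCast_pow hnpos.le (by omega)
  have hs8 : 8 ≤ s := by
    refine le_of_pow_le_pow_left₀ (n := k) (by omega) hs0 ?_
    rw [hsk]; exact_mod_cast hn
  set m := ⌊s / 2⌋₊ with hm
  have hm1 : (m : ℝ) ≤ s / 2 := Nat.floor_le (by positivity)
  have hm2 : s / 2 < m + 1 := Nat.lt_floor_add_one _
  have hm3 : 1 ≤ m := by
    have : (0 : ℝ) < m := by linarith
    exact_mod_cast this
  obtain ⟨Δ, hΔ⟩ : ∃ Δ, m = Δ + 1 := ⟨m - 1, by omega⟩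
  have hpow : 2 * (Δ + 1) ^ k ≤ n := by
    rw [← hΔ]
    have h1 : ((m : ℝ)) ^ k ≤ (s / 2) ^ k := pow_le_pow_left₀ (by positivity) hm1 k
    rw [div_pow, hsk] at h1
    have h2 : (2 : ℝ) ≤ 2 ^ k := le_self_pow₀ (by norm_num) (by omega)
    rw [le_div_iff₀ (by positivity)] at h1
    have h3 : (2 : ℝ) * (m : ℝ) ^ k ≤ n := by
      have : (m : ℝ) ^ k * 2 ≤ (m : ℝ) ^ k * 2 ^ k := mul_le_mul_of_nonneg_left h2 (by positivity)
      linarith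
    exact_mod_cast h3
  obtain ⟨G, hG, hE⟩ := graph_aux n Δ k hk hpow
  obtain ⟨inst, hadj, hwalk⟩ := metric_aux G k
  refine ⟨Fin n, inst, inferInstance, by simp, ?_⟩
  intro Y _ _ f χ hY hf
  have hkpos : (0 : ℝ) ≤ k := by positivity
  have hkey := @key_aux (Fin n) Y inst _ _ G (k + 1) (1 / 3 * (k : ℝ)) (by positivity)
    (by push_cast; linarith) hG hadj
    (fun x y h => hwalk x y (h.trans (by linarith))) f χ hY hf
  have h1 : ((Δ * n : ℕ) : ℝ) ≤ ((4 * ∑ x, (f x).card : ℕ) : ℝ) := by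
    exact_mod_cast hE.trans (Nat.mul_le_mul_left 4 (by convert hkey))
  push_cast at h1
  have h2 : (n : ℝ) ^ (1 + 1 / (k : ℝ)) = n * s := by
    rw [Real.rpow_add hnpos, Real.rpow_one]
  rw [h2]
  have h3 : s / 4 ≤ (Δ : ℝ) := by
    have : (m : ℝ) = Δ + 1 := by exact_mod_cast hΔ
    linarith
  have h4 : s / 4 * n ≤ Δ * n := mul_le_mul_of_nonneg_right h3 hnpos.le
  linarith
end

section
/- There is a universal constant c > 0 such that for every ε ∈ (0,1) there is N ∈ ℕ so that for every n ≥ N there exists a simple graph G on n vertices with at least (1+ε)·n edges and girth at least c·(log₂ n)/ε. -/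
namespace LargeGirth

open SimpleGraph

variable {V : Type*}

lemma transfer_walk {G : SimpleGraph V} {u v : V} {x y : V}
    (p : (G ⊔ edge u v).Walk x y) (h : s(u, v) ∉ p.edges) :
    ∃ h' : ∀ e ∈ p.edges, e ∈ G.edgeSet, (p.transfer G h').length = p.length := by
  have h' : ∀ e ∈ p.edges, e ∈ G.edgeSet := by
    intro e he
    have := p.edges_subset_edgeSet he
    rw [edgeSet_sup] at this
    rcases this with h1 | h1
    · exact h1
    · exfalso
      induction e with
      | _ a b =>
        rw [mem_edgeSet, adj_edge] at h1
        exact h (h1.1 ▸ he)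
  exact ⟨h', by simp⟩

lemma split_walk_mem {G : SimpleGraph V} {u v : V} {x y : V}
    (p : (G ⊔ edge u v).Walk x y) (hp : p.edges.Nodup) (hm : s(u, v) ∈ p.edges) :
    (∃ (q₁ : G.Walk x u) (q₂ : G.Walk v y), q₁.length + q₂.length + 1 = p.length) ∨
    (∃ (q₁ : G.Walk x v) (q₂ : G.Walk u y), q₁.length + q₂.length + 1 = p.length) := by
  induction p with
  | nil => simp at hm
  | @cons a b c h p ih =>
    rw [Walk.edges_cons, List.nodup_cons] at hp
    rw [Walk.edges_cons, List.mem_cons] at hm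
    by_cases hab : s(u, v) = s(a, b)
    · obtain ⟨h', hl⟩ := transfer_walk p (hab ▸ hp.1)
      rw [Sym2.eq_iff] at hab
      rcases hab with ⟨rfl, rfl⟩ | ⟨rfl, rfl⟩
      · left
        exact ⟨Walk.nil, p.transfer G h', by simp⟩
      · right
        exact ⟨Walk.nil, p.transfer G h', by simp⟩
    · have hadj : G.Adj a b := by
        rw [sup_adj, adj_edge] at h
        tauto
      have hm' : s(u, v) ∈ p.edges := by tauto
      rcases ih hp.2 hm' with ⟨q₁, q₂, hq⟩ | ⟨q₁, q₂, hq⟩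
      · left
        exact ⟨Walk.cons hadj q₁, q₂, by simp; omega⟩
      · right
        exact ⟨Walk.cons hadj q₁, q₂, by simp; omega⟩

/-- Adding an edge between two far-away vertices keeps the girth large. -/
lemma girth_add_edge {G : SimpleGraph V} {u v : V} {g : ℕ}
    (hG : ∀ a (w : G.Walk a a), w.IsCycle → g ≤ w.length)
    (hd : ∀ w : G.Walk u v, g ≤ w.length + 1) :
    ∀ a (w : (G ⊔ edge u v).Walk a a), w.IsCycle → g ≤ w.length := by
  intro a w hw
  by_cases hm : s(u, v) ∈ w.edges
  · rcases split_walk_mem w hw.edges_nodup hm with ⟨q₁, q₂, hq⟩ | ⟨q₁, q₂, hq⟩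
    · have := hd (q₂.append q₁).reverse
      simp at this
      omega
    · have := hd (q₂.append q₁)
      simp at this
      omega
  · obtain ⟨h', hl⟩ := transfer_walk w hm
    rw [← hl]
    exact hG a _ (hw.transfer h')

/-- Ball growth measured in blocks. -/
lemma ball_bound {B : Type*} {G : SimpleGraph V} (β : V → B) (s : ℕ) (F : B → Finset B)
    (hF : ∀ b, (F b).card ≤ 7)
    (hw : ∀ x y (w : G.Walk x y), w.length ≤ s → β y ∈ F (β x)) (j : ℕ) :
    ∀ b : B, ∃ T : Finset B, T.card ≤ 7 ^ j ∧
      ∀ x y (w : G.Walk x y), β x = b → w.length ≤ s * j → β y ∈ T := by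
  classical
  induction j with
  | zero =>
    intro b
    refine ⟨{b}, by simp, ?_⟩
    intro x y w hx hl
    have : x = y := Walk.eq_of_length_eq_zero (by simpa using hl)
    simp [← this, hx]
  | succ j ih =>
    intro b
    choose T hT1 hT2 using ih
    refine ⟨(F b).biUnion T, ?_, ?_⟩
    · calc _ ≤ (F b).card * 7 ^ j := Finset.card_biUnion_le_card_mul _ _ _ (fun c _ => hT1 c)
        _ ≤ 7 * 7 ^ j := Nat.mul_le_mul_right _ (hF b)
        _ = 7 ^ (j + 1) := by ring
    · intro x y w hx hl
      rw [Finset.mem_biUnion]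
      refine ⟨β (w.getVert s), ?_, ?_⟩
      · rw [← hx]
        exact hw _ _ (w.take s) (by simp [Walk.take_length])
      · refine hT2 _ _ _ (w.drop s) rfl ?_
        rw [Walk.drop_length]
        rw [Nat.mul_succ] at hl
        omega

/-- The class of graphs considered by the greedy algorithm. -/
def Good (P : SimpleGraph V) (M : Finset V) (d : ℕ) (G : SimpleGraph V) : Prop :=
  P ≤ G ∧ (∀ x y, (G \ P).Adj x y → x ∈ M) ∧ ∀ x, ((G \ P).neighborSet x).ncard ≤ d

lemma greedy [Fintype V] {B : Type*} (P : SimpleGraph V) (hP : P.IsAcyclic) (M : Finset V)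
    (d j s : ℕ) (hj : 1 ≤ j) (hs : 1 ≤ s) (β : V → B) (hβ : Set.InjOn β M)
    (hF : ∀ G, Good P M d G → ∃ F : B → Finset B, (∀ b, (F b).card ≤ 7) ∧
      ∀ x y (w : G.Walk x y), w.length ≤ s → β y ∈ F (β x)) :
    ∃ G : SimpleGraph V, P.edgeSet.ncard * 2 + d * M.card ≤ G.edgeSet.ncard * 2 + d * 7 ^ j ∧
      ∀ a (w : G.Walk a a), w.IsCycle → s * j + 2 ≤ w.length := by
  classical
  let S : Set (SimpleGraph V) := {G | Good P M d G ∧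
    ∀ a (w : G.Walk a a), w.IsCycle → s * j + 2 ≤ w.length}
  have hPS : P ∈ S := by
    refine ⟨⟨le_rfl, ?_, ?_⟩, fun a w hw => (hP w hw).elim⟩
    · simp
    · intro x
      simp
  obtain ⟨G, hGm⟩ := (Set.toFinite S).exists_maximal ⟨P, hPS⟩
  obtain ⟨⟨hG1, hG2, hG3⟩, hGg⟩ := hGm.1
  refine ⟨G, ?_, hGg⟩
  let U : Finset V := M.filter fun x => ((G \ P).neighborSet x).ncard < d
  have hsj : 1 ≤ s * j := Nat.mul_pos hs hj
  -- any two unsaturated vertices are close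
  have hclose : ∀ u ∈ U, ∀ v ∈ U, ∃ w : G.Walk u v, w.length ≤ s * j := by
    intro u hu v hv
    by_contra! hcon
    have huv : u ≠ v := by
      rintro rfl
      have := hcon Walk.nil
      simp at this
    have hnadj : ¬ G.Adj u v := by
      intro h
      have := hcon (Walk.cons h Walk.nil)
      simp at this
      omega
    simp only [U, Finset.mem_filter] at hu hv
    have hnb : ∀ x, ((G ⊔ edge u v) \ P).neighborSet x ⊆
        (G \ P).neighborSet x ∪ (if x = u then {v} else if x = v then {u} else ∅) := by
      intro x y hy
      simp only [mem_neighborSet, sdiff_adj, sup_adj, edge_adj, Set.mem_union] at hy ⊢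
      split_ifs <;> simp only [Set.mem_singleton_iff, Set.mem_empty_iff_false] <;> grind
    have hmem : (G ⊔ edge u v) ∈ S := by
      refine ⟨⟨hG1.trans le_sup_left, ?_, ?_⟩, ?_⟩
      · intro x y hxy
        rw [sdiff_adj, sup_adj, edge_adj] at hxy
        rcases hxy with ⟨h1 | h1, h2⟩
        · exact hG2 x y (by rw [sdiff_adj]; exact ⟨h1, h2⟩)
        · rcases h1.1 with h | h
          · rw [h.1]; exact hu.1
          · rw [h.1]; exact hv.1
      · intro x
        refine (Set.ncard_le_ncard (hnb x) (Set.toFinite _)).trans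
          ((Set.ncard_union_le _ _).trans ?_)
        have := hG3 x
        split_ifs with h1 h2
        · subst h1; rw [Set.ncard_singleton]; omega
        · subst h2; rw [Set.ncard_singleton]; omega
        · simpa using this
      · exact girth_add_edge hGg (fun w => by have := hcon w; omega)
    have hle := hGm.2 hmem le_sup_left
    exact hnadj (hle (by rw [sup_adj, edge_adj]; tauto))
  have hU : U.card ≤ 7 ^ j := by
    rcases U.eq_empty_or_nonempty with h | ⟨u, hu⟩
    · simp [h]
    obtain ⟨F, hF1, hF2⟩ := hF G ⟨hG1, hG2, hG3⟩
    obtain ⟨T, hT1, hT2⟩ := ball_bound β s F hF1 hF2 j (β u)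
    refine le_trans ?_ hT1
    refine Finset.card_le_card_of_injOn β ?_ (hβ.mono ?_)
    · intro v hv
      obtain ⟨w, hw⟩ := hclose u hu v hv
      exact hT2 u v w rfl hw
    · intro v hv
      exact (Finset.mem_filter.1 hv).1
  -- counting
  have hdeg : ∀ x, (G \ P).degree x = ((G \ P).neighborSet x).ncard := by
    intro x
    rw [← card_neighborSet_eq_degree, Set.ncard_eq_toFinset_card', Set.toFinset_card]
  have hsum := (G \ P).sum_degrees_eq_twice_card_edges
  have h1 : d * (M \ U).card ≤ ∑ x, (G \ P).degree x := by
    calc d * (M \ U).card = ∑ x ∈ M \ U, d := by simp [mul_comm]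
      _ ≤ ∑ x ∈ M \ U, (G \ P).degree x := by
        refine Finset.sum_le_sum fun x hx => ?_
        rw [hdeg]
        simp only [U, Finset.mem_sdiff, Finset.mem_filter] at hx
        by_contra! h
        exact hx.2 ⟨hx.1, h⟩
      _ ≤ _ := Finset.sum_le_univ_sum_of_nonneg (fun _ => Nat.zero_le _)
  have h2 : ∑ x, (G \ P).degree x = 2 * (G \ P).edgeSet.ncard := by
    rw [hsum, Set.ncard_eq_toFinset_card', edgeFinset]
    congr 2
    ext e; simp
  have h3 : (G \ P).edgeSet.ncard + P.edgeSet.ncard = G.edgeSet.ncard := by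
    rw [edgeSet_sdiff]
    exact Set.ncard_sdiff_add_ncard_of_subset (edgeSet_mono hG1) (Set.toFinite _)
  have h4 : M.card ≤ (M \ U).card + U.card := by
    have := Finset.le_card_sdiff U M
    omega
  have h5 : d * M.card ≤ d * (M \ U).card + d * 7 ^ j := by
    rw [← mul_add]
    exact Nat.mul_le_mul_left _ (by omega)
  omega

lemma pathGraph_facts (m : ℕ) :
    (pathGraph (m + 1)).IsAcyclic ∧ (pathGraph (m + 1)).edgeSet.ncard = m := by
  have hc := pathGraph_connected m
  have hE : (pathGraph (m + 1)).edgeSet =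
      Set.range (fun i : Fin m => s(i.castSucc, i.succ)) := by
    ext e
    induction e with
    | _ a b =>
      rw [mem_edgeSet, pathGraph_adj]
      simp only [Set.mem_range, Sym2.eq_iff]
      constructor
      · rintro (h | h)
        · refine ⟨⟨a, by omega⟩, Or.inl ⟨?_, ?_⟩⟩ <;> ext <;> simp <;> omega
        · refine ⟨⟨b, by omega⟩, Or.inr ⟨?_, ?_⟩⟩ <;> ext <;> simp <;> omega
      · rintro ⟨i, ⟨rfl, rfl⟩ | ⟨rfl, rfl⟩⟩ <;> simp
  have hcard : (pathGraph (m + 1)).edgeSet.ncard = m := by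
    rw [hE, Set.ncard_range_of_injective]
    · simp
    · intro i k h
      simp only [Sym2.eq_iff, Fin.ext_iff, Fin.val_castSucc, Fin.val_succ] at h
      ext; omega
  refine ⟨?_, hcard⟩
  have : (pathGraph (m + 1)).IsTree := by
    rw [isTree_iff_connected_and_card]
    refine ⟨hc, ?_⟩
    rw [Nat.card_coe_set_eq, hcard]
    simp
  exact this.isAcyclic

/-- A graph with at least as many edges as vertices has a cycle. -/
lemma not_acyclic {n : ℕ} (hn : 0 < n) (G : SimpleGraph (Fin n)) (h : n ≤ G.edgeSet.ncard) :
    ¬ G.IsAcyclic := by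
  classical
  intro hG
  have : Nonempty (Fin n) := ⟨⟨0, hn⟩⟩
  obtain ⟨T, hT1, hT2, hT3⟩ := (connected_top (V := Fin n)).exists_isTree_le_of_le_of_isAcyclic
    (le_top : G ≤ ⊤) hG
  have h1 := (isTree_iff_connected_and_card.1 hT3).2
  rw [Nat.card_coe_set_eq] at h1
  have h2 := Set.ncard_le_ncard (edgeSet_mono hT1) (Set.toFinite _)
  simp at h1
  omega

/-- The plain case: bounded degree, no base graph. -/
lemma plain_case (n j : ℕ) (hj : 1 ≤ j) :
    ∃ G : SimpleGraph (Fin n), 6 * n ≤ G.edgeSet.ncard * 2 + 6 * 7 ^ j ∧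
      ∀ a (w : G.Walk a a), w.IsCycle → j + 2 ≤ w.length := by
  classical
  obtain ⟨G, h1, h2⟩ := greedy (⊥ : SimpleGraph (Fin n)) isAcyclic_bot Finset.univ 6 j 1 hj le_rfl
    (id : Fin n → Fin n) (Set.injOn_id _) (by
      rintro G ⟨-, -, h3⟩
      simp only [sdiff_bot] at h3
      refine ⟨fun x => insert x (G.neighborFinset x), ?_, ?_⟩
      · intro x
        refine (Finset.card_insert_le _ _).trans ?_
        have := h3 x
        rw [Set.ncard_eq_toFinset_card'] at this
        have h : (G.neighborFinset x).card ≤ 6 := by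
          convert this using 2
          ext y; simp
        omega
      · intro x y w hw
        cases w with
        | nil => simp
        | cons h p =>
          have hp : p.length = 0 := by simp at hw; simp [hw]
          have := Walk.eq_of_length_eq_zero hp
          subst this
          simp [h])
  refine ⟨G, ?_, ?_⟩
  · simpa using h1
  · simpa using h2

/-- Invariant for short walks in path plus matching. -/
lemma walk_invariant {n k : ℕ} (hk : 1 ≤ k) (G : SimpleGraph (Fin n))
    (Q : ℕ → Finset ℕ)
    (hQ : ∀ x y, G.Adj x y → (x.val + 1 = y.val ∨ y.val + 1 = x.val) ∨
      (k ∣ x.val ∧ k ∣ y.val ∧ y.val ∈ Q x.val))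
    (hQ1 : ∀ a b c, b ∈ Q a → c ∈ Q b → c = a) (hQk : ∀ a b, b ∈ Q a → k ∣ b)
    (i : ℕ) {x y : Fin n} (w : G.Walk x y) (hx1 : i * k ≤ x.val) (hx2 : x.val ≤ (i + 1) * k)
    (hw : w.length + 1 ≤ k) :
    (i * k ≤ y.val + w.length ∧ y.val ≤ (i + 1) * k + w.length) ∨
    ∃ q ∈ Q (i * k) ∪ Q ((i + 1) * k), q ≤ y.val + w.length ∧ y.val ≤ q + w.length := by
  classical
  induction w using Walk.concatRec with
  | Hnil => left; simp; omega
  | @Hconcat x z y p h ih =>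
    rw [Walk.length_concat] at hw ⊢
    have key : ∀ a b : ℕ, a * k < b * k + k → b * k < a * k + k → a = b := by
      intro a b h1 h2
      have h3 : a < b + 1 := by
        by_contra! h; have := Nat.mul_le_mul_right k h; rw [add_mul] at this; omega
      have h4 : b < a + 1 := by
        by_contra! h; have := Nat.mul_le_mul_right k h; rw [add_mul] at this; omega
      omega
    have e1 : (i + 1) * k = i * k + k := by ring
    rcases ih hx1 hx2 (by omega) with ⟨h1, h2⟩ | ⟨q, hq, h1, h2⟩
    · rcases hQ _ _ h with hs | ⟨hz, hy, hyQ⟩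
      · left; omega
      · right
        refine ⟨y.val, ?_, by omega, by omega⟩
        obtain ⟨t, ht⟩ := hz
        have ht' : z.val = t * k := by rw [ht, mul_comm]
        have : t = i ∨ t = i + 1 := by
          by_cases hti : t * k < i * k + k
          · left; exact key _ _ hti (by omega)
          · right; refine key _ _ (by omega) (by omega)
        rw [Finset.mem_union]
        rcases this with rfl | rfl
        · left; rwa [← ht']
        · right; rwa [← ht']
    · rcases hQ _ _ h with hs | ⟨hz, hy, hyQ⟩
      · right; exact ⟨q, hq, by omega, by omega⟩
      · left
        have hkq : k ∣ q := by
          rw [Finset.mem_union] at hq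
          rcases hq with hq | hq <;> exact hQk _ _ hq
        obtain ⟨t, ht⟩ := hz
        have ht' : z.val = t * k := by rw [ht, mul_comm]
        obtain ⟨r, hr⟩ := hkq
        have hr' : q = r * k := by rw [hr, mul_comm]
        have htr : t = r := key _ _ (by omega) (by omega)
        have hzq : z.val = q := by rw [ht', hr', htr]
        rw [hzq] at hyQ
        rw [Finset.mem_union] at hq
        rcases hq with hq | hq
        · have := hQ1 _ _ _ hq hyQ; omega
        · have := hQ1 _ _ _ hq hyQ; omega

lemma block_of_near {k q y l : ℕ} (hk : 1 ≤ k) (hq : k ∣ q) (hl : l + 1 ≤ k)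
    (h1 : q ≤ y + l) (h2 : y ≤ q + l) : y / k = q / k - 1 ∨ y / k = q / k := by
  obtain ⟨r, rfl⟩ := hq
  rw [Nat.mul_div_cancel_left _ (by omega)]
  have h3 : y / k < r + 1 := by
    rw [Nat.div_lt_iff_lt_mul (by omega), add_mul, mul_comm r k]; omega
  have h4 : r - 1 ≤ y / k := by
    rw [Nat.le_div_iff_mul_le (by omega), Nat.sub_mul, mul_comm r k]; omega
  omega

/-- The path case: a Hamiltonian path plus a sparse matching of chords. -/
lemma path_case (m j k : ℕ) (hj : 1 ≤ j) (hk : 2 ≤ k) :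
    ∃ G : SimpleGraph (Fin (m + 1)),
      m * 2 + (m / k + 1) ≤ G.edgeSet.ncard * 2 + 7 ^ j ∧
      ∀ a (w : G.Walk a a), w.IsCycle → (k - 1) * j + 2 ≤ w.length := by
  classical
  obtain ⟨hac, hcard⟩ := pathGraph_facts m
  let M : Finset (Fin (m + 1)) := Finset.univ.filter fun x => k ∣ x.val
  have hM : m / k + 1 ≤ M.card := by
    have : (Finset.univ : Finset (Fin (m / k + 1))).card ≤ M.card := by
      refine Finset.card_le_card_of_injOn
        (fun i => ⟨k * i.val, ?_⟩) ?_ ?_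
      · have := Nat.mul_le_mul_left k (Nat.lt_succ_iff.1 i.2)
        have := Nat.mul_div_le m k
        omega
      · intro i _
        simp [M]
      · intro a _ b _ h
        simp only [Fin.mk.injEq] at h
        exact Fin.ext (Nat.eq_of_mul_eq_mul_left (by omega) h)
    simpa using this
  obtain ⟨G, h1, h2⟩ := greedy (pathGraph (m + 1)) hac M 1 j (k - 1) hj (by omega)
    (fun x => x.val / k) (by
      intro x hx y hy h
      simp only [M, Finset.coe_filter, Finset.mem_univ, true_and, Set.mem_ofPred_eq] at hx hy
      ext
      exact Nat.div_left_inj hx hy |>.1 h) (by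
      rintro G ⟨hg1, hg2, hg3⟩
      let C := G \ pathGraph (m + 1)
      let Q : ℕ → Finset ℕ := fun a =>
        (Finset.univ.filter fun z : Fin (m + 1) => ∃ x : Fin (m + 1), x.val = a ∧ C.Adj x z).image
          (fun z => z.val)
      have memQ : ∀ a b, b ∈ Q a ↔ ∃ x y : Fin (m + 1), x.val = a ∧ y.val = b ∧ C.Adj x y := by
        intro a b
        simp only [Q, Finset.mem_image, Finset.mem_filter, Finset.mem_univ, true_and]
        constructor
        · rintro ⟨z, ⟨x, hx, hz⟩, hb⟩; exact ⟨x, z, hx, hb, hz⟩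
        · rintro ⟨x, z, hx, hb, hz⟩; exact ⟨z, ⟨x, hx, hz⟩, hb⟩
      have uniq : ∀ x y z, C.Adj x y → C.Adj x z → y = z := by
        intro x y z hy hz
        exact (Set.ncard_le_one (Set.toFinite _)).1 (hg3 x) y hy z hz
      have hdvd : ∀ x y, C.Adj x y → k ∣ x.val := by
        intro x y h
        have := hg2 x y h
        simpa [M] using this
      have hQc : ∀ a, (Q a).card ≤ 1 := by
        intro a
        rw [Finset.card_le_one]
        intro b hb c hc
        rw [memQ] at hb hc
        obtain ⟨x, y, hx, hy, hxy⟩ := hb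
        obtain ⟨x', y', hx', hy', hxy'⟩ := hc
        have : x = x' := Fin.ext (by omega)
        subst this
        rw [← hy, ← hy', uniq _ _ _ hxy hxy']
      have hQk : ∀ a b, b ∈ Q a → k ∣ b := by
        intro a b hb
        rw [memQ] at hb
        obtain ⟨x, y, hx, hy, hxy⟩ := hb
        rw [← hy]
        exact hdvd _ _ hxy.symm
      have hQ1 : ∀ a b c, b ∈ Q a → c ∈ Q b → c = a := by
        intro a b c hb hc
        rw [memQ] at hb hc
        obtain ⟨x, y, hx, hy, hxy⟩ := hb
        obtain ⟨x', y', hx', hy', hxy'⟩ := hc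
        have : x' = y := Fin.ext (by omega)
        subst this
        rw [← hx, ← hy', uniq _ _ _ hxy.symm hxy']
      have hQ : ∀ x y, G.Adj x y → (x.val + 1 = y.val ∨ y.val + 1 = x.val) ∨
          (k ∣ x.val ∧ k ∣ y.val ∧ y.val ∈ Q x.val) := by
        intro x y hxy
        by_cases hp : (pathGraph (m + 1)).Adj x y
        · left; exact pathGraph_adj.1 hp
        · right
          have hC : C.Adj x y := by
            simp only [C, sdiff_adj]; exact ⟨hxy, hp⟩
          exact ⟨hdvd _ _ hC, hdvd _ _ hC.symm, (memQ _ _).2 ⟨x, y, rfl, rfl, hC⟩⟩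
      let R : ℕ → Finset ℕ := fun a => (Q a).biUnion fun q => {q / k - 1, q / k}
      have hR : ∀ a, (R a).card ≤ 2 := by
        intro a
        calc (R a).card ≤ (Q a).card * 2 :=
              Finset.card_biUnion_le_card_mul _ _ _ (fun q _ => Finset.card_le_two)
          _ ≤ 2 := by have := hQc a; omega
      refine ⟨fun b => {b - 1, b, b + 1} ∪ (R (b * k) ∪ R ((b + 1) * k)), ?_, ?_⟩
      · intro b
        have e1 := Finset.card_union_le ({b - 1, b, b + 1} : Finset ℕ) (R (b * k) ∪ R ((b + 1) * k))
        have e2 := Finset.card_union_le (R (b * k)) (R ((b + 1) * k))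
        have e3 : ({b - 1, b, b + 1} : Finset ℕ).card ≤ 3 := Finset.card_le_three
        have e4 := hR (b * k)
        have e5 := hR ((b + 1) * k)
        beta_reduce
        omega
      · intro x y w hw
        have hkp : 0 < k := by omega
        have hx1 : x.val / k * k ≤ x.val := Nat.div_mul_le_self _ _
        have hx2 : x.val ≤ (x.val / k + 1) * k := by
          have := Nat.lt_div_mul_add (a := x.val) hkp
          rw [add_mul]; omega
        have hinv := walk_invariant (by omega) G Q hQ hQ1 hQk (x.val / k) w hx1 hx2 (by omega)
        simp only [Finset.mem_union, Finset.mem_insert, Finset.mem_singleton, R, Finset.mem_biUnion]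
        generalize x.val / k = b at *
        rcases hinv with ⟨h1, h2⟩ | ⟨q, hq, h1, h2⟩
        · left
          have h3 : y.val / k < b + 2 := by
            rw [Nat.div_lt_iff_lt_mul hkp]
            have : (b + 2) * k = (b + 1) * k + k := by ring
            omega
          have h4 : b - 1 ≤ y.val / k := by
            rw [Nat.le_div_iff_mul_le hkp, Nat.sub_mul]
            omega
          omega
        · right
          rw [Finset.mem_union] at hq
          rcases hq with hq | hq
          · left
            exact ⟨q, hq, block_of_near (by omega) (hQk _ _ hq) (by omega) h1 h2⟩
          · right
            exact ⟨q, hq, block_of_near (by omega) (hQk _ _ hq) (by omega) h1 h2⟩)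
  refine ⟨G, ?_, h2⟩
  rw [hcard] at h1
  omega

lemma log_bound (x : ℝ) (hx : 1 ≤ x) (j : ℕ) (h : x ≤ 7 ^ j) : Real.logb 2 x ≤ 3 * j := by
  rw [Real.logb_le_iff_le_rpow (by norm_num) (by linarith)]
  calc x ≤ 7 ^ j := h
    _ ≤ 8 ^ j := by gcongr; norm_num
    _ = (2 : ℝ) ^ (3 * (j : ℝ)) := by
      rw [Real.rpow_mul (by norm_num), Real.rpow_natCast]; norm_num

lemma main_plain (ε : ℝ) (h1 : ε < 1) (h8 : 1 / 8 < ε) (n : ℕ) (hn : 28 ≤ n) :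
    ∃ G : SimpleGraph (Fin n), (1 + ε) * (n : ℝ) ≤ (G.edgeSet.ncard : ℝ) ∧
      ∀ a (w : G.Walk a a), w.IsCycle → 1 / 200 * Real.logb 2 n / ε ≤ (w.length : ℝ) := by
  have hj : 1 ≤ Nat.log 7 (n / 4) := by
    rw [Nat.one_le_iff_ne_zero, Ne, Nat.log_eq_zero_iff]; omega
  have hj1 : 7 ^ Nat.log 7 (n / 4) ≤ n / 4 := Nat.pow_log_le_self _ (by omega)
  have hj2 : n / 4 < 7 ^ (Nat.log 7 (n / 4) + 1) := Nat.lt_pow_succ_log_self (by norm_num) _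
  generalize Nat.log 7 (n / 4) = j at *
  obtain ⟨G, hG1, hG2⟩ := plain_case n j hj
  refine ⟨G, ?_, fun a w hw => ?_⟩
  · have : 2 * n ≤ G.edgeSet.ncard := by omega
    have h : (2 : ℝ) * n ≤ G.edgeSet.ncard := by exact_mod_cast this
    have hn0 : (0 : ℝ) ≤ n := Nat.cast_nonneg _
    nlinarith
  · have hl := hG2 a w hw
    have hl' : (j : ℝ) + 2 ≤ w.length := by exact_mod_cast hl
    have hb : (n : ℝ) ≤ 7 ^ (j + 2) := by
      have : n ≤ 7 ^ (j + 2) := by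
        rw [pow_succ]; omega
      exact_mod_cast this
    have hlog := log_bound n (by exact_mod_cast (by omega : 1 ≤ n)) (j + 2) hb
    push_cast at hlog
    rw [div_le_iff₀ (by linarith)]
    have : (0 : ℝ) ≤ j := Nat.cast_nonneg _
    nlinarith

lemma main_path (ε : ℝ) (h0 : 0 < ε) (h8 : ε ≤ 1 / 8) (n : ℕ)
    (hn : 28 * ⌊1 / (4 * ε)⌋₊ ^ 2 + ⌈2 / ε⌉₊ ≤ n) :
    ∃ G : SimpleGraph (Fin n), (1 + ε) * (n : ℝ) ≤ (G.edgeSet.ncard : ℝ) ∧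
      ∀ a (w : G.Walk a a), w.IsCycle → 1 / 200 * Real.logb 2 n / ε ≤ (w.length : ℝ) := by
  have hk2 : 2 ≤ ⌊1 / (4 * ε)⌋₊ := by
    apply Nat.le_floor
    rw [le_div_iff₀ (by linarith)]
    push_cast
    linarith
  have hk1 : (⌊1 / (4 * ε)⌋₊ : ℝ) ≤ 1 / (4 * ε) := Nat.floor_le (by positivity)
  have hk3 : 1 / (4 * ε) < ⌊1 / (4 * ε)⌋₊ + 1 := Nat.lt_floor_add_one _
  generalize ⌊1 / (4 * ε)⌋₊ = k at *
  have hk2' : (2 : ℝ) ≤ k := by exact_mod_cast hk2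
  have hεn : 2 ≤ ε * n := by
    have h1 : 2 / ε ≤ ⌈2 / ε⌉₊ := Nat.le_ceil _
    have h2 : (⌈2 / ε⌉₊ : ℝ) ≤ n := by exact_mod_cast (by omega : ⌈2 / ε⌉₊ ≤ n)
    have h3 := h1.trans h2
    rw [div_le_iff₀ h0] at h3
    linarith
  have hnk : 28 * k ^ 2 ≤ n := by omega
  have hnk1 : 28 * k ≤ n := by nlinarith
  have hd7 : 7 ≤ n / (4 * k) := by
    rw [Nat.le_div_iff_mul_le (by omega)]; omega
  have hj : 1 ≤ Nat.log 7 (n / (4 * k)) := by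
    rw [Nat.one_le_iff_ne_zero, Ne, Nat.log_eq_zero_iff]; omega
  have hj1 : 7 ^ Nat.log 7 (n / (4 * k)) ≤ n / (4 * k) := Nat.pow_log_le_self _ (by omega)
  have hj2 : n / (4 * k) < 7 ^ (Nat.log 7 (n / (4 * k)) + 1) :=
    Nat.lt_pow_succ_log_self (by norm_num) _
  generalize Nat.log 7 (n / (4 * k)) = j at *
  obtain ⟨m, rfl⟩ : ∃ m, n = m + 1 := ⟨n - 1, by omega⟩
  obtain ⟨G, hG1, hG2⟩ := path_case m j k hj hk2
  have hke : (k : ℝ) * (4 * ε) ≤ 1 := by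
    rwa [le_div_iff₀ (by linarith)] at hk1
  have hke' : 1 < ((k : ℝ) + 1) * (4 * ε) := by
    rwa [div_lt_iff₀ (by linarith)] at hk3
  refine ⟨G, ?_, fun a w hw => ?_⟩
  · set N : ℝ := ((m + 1 : ℕ) : ℝ) with hN
    have hNm : N = (m : ℝ) + 1 := by rw [hN]; push_cast; ring
    have a1 : (m : ℝ) * 2 + ((m / k + 1 : ℕ) : ℝ) ≤ G.edgeSet.ncard * 2 + 7 ^ j := by
      exact_mod_cast hG1
    have a2 : N ≤ ((m / k + 1 : ℕ) : ℝ) * k := by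
      have : m + 1 ≤ (m / k + 1) * k := by
        have := Nat.lt_div_mul_add (a := m) (b := k) (by omega)
        rw [add_mul]; omega
      rw [hN]; exact_mod_cast this
    have a3 : (7 : ℝ) ^ j * (4 * k) ≤ N := by
      have := (Nat.mul_le_mul_right (4 * k) hj1).trans (Nat.div_mul_le_self _ _)
      rw [hN]; exact_mod_cast this
    generalize ((m / k + 1 : ℕ) : ℝ) = A at *
    generalize (7 : ℝ) ^ j = B at *
    have hkpos : (0 : ℝ) < k := by linarith
    have hN0 : (0 : ℝ) ≤ N := by rw [hN]; positivity
    -- A - B ≥ 3 N / (4k) ≥ 3 ε N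
    have a4 : 3 * ε * N ≤ A - B := by
      have : 3 * ε * N * k ≤ (A - B) * k := by nlinarith
      exact le_of_mul_le_mul_right this hkpos
    nlinarith
  · have hl := hG2 a w hw
    have hl' : ((k : ℝ) - 1) * j + 2 ≤ w.length := by
      have : (((k - 1 : ℕ) : ℝ)) * j + 2 ≤ w.length := by exact_mod_cast hl
      rwa [Nat.cast_sub (by omega), Nat.cast_one] at this
    have hb : m + 1 ≤ 7 ^ (2 * (j + 1)) := by
      have b1 : m + 1 < 7 ^ (j + 1) * (4 * k) := by
        rwa [Nat.div_lt_iff_lt_mul (by omega)] at hj2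
      rw [mul_comm, pow_mul]
      generalize 7 ^ (j + 1) = X at *
      have b2 : 4 * k ≤ X := by
        by_contra! h
        nlinarith
      nlinarith
    have hlog := log_bound ((m + 1 : ℕ) : ℝ) (by exact_mod_cast (by omega : 1 ≤ m + 1))
      (2 * (j + 1)) (by exact_mod_cast hb)
    push_cast at hlog ⊢
    generalize Real.logb 2 ((m : ℝ) + 1) = L at *
    rw [div_le_iff₀ h0]
    have hj' : (1 : ℝ) ≤ j := by exact_mod_cast hj
    have c1 : 1 / 16 ≤ ((k : ℝ) - 1) * ε := by nlinarith
    have c2 : 1 / 16 * (j : ℝ) ≤ ((k : ℝ) - 1) * ε * j :=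
      mul_le_mul_of_nonneg_right c1 (by linarith)
    nlinarith

end LargeGirth

/-- for every `ε ∈ (0,1)` and all sufficiently large `n` there exists a
simple graph on `n` vertices with at least `(1+ε)·n` edges and girth at least
`c·log₂(n)/ε`. -/
theorem graph_many_edges_large_girth_eps :
    ∃ c : ℝ, 0 < c ∧
      ∀ ε : ℝ, 0 < ε → ε < 1 →
      ∃ N : ℕ, ∀ n : ℕ, N ≤ n →
      ∃ G : SimpleGraph (Fin n),
        (1 + ε) * (n : ℝ) ≤ (G.edgeSet.ncard : ℝ) ∧
        ∀ g : ℕ, G.girth = (g : ℕ∞) → c * Real.logb 2 n / ε ≤ (g : ℝ) := by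
  refine ⟨1 / 200, by norm_num, fun ε h0 h1 => ?_⟩
  have key : ∃ N : ℕ, ∀ n : ℕ, N ≤ n → ∃ G : SimpleGraph (Fin n),
      (1 + ε) * (n : ℝ) ≤ (G.edgeSet.ncard : ℝ) ∧
      ∀ a (w : G.Walk a a), w.IsCycle → 1 / 200 * Real.logb 2 n / ε ≤ (w.length : ℝ) := by
    by_cases h8 : ε ≤ 1 / 8
    · exact ⟨_, fun n hn => LargeGirth.main_path ε h0 h8 n hn⟩
    · exact ⟨28, fun n hn => LargeGirth.main_plain ε h1 (not_le.1 h8) n hn⟩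
  obtain ⟨N, hN⟩ := key
  refine ⟨N + 1, fun n hn => ?_⟩
  obtain ⟨G, hG1, hG2⟩ := hN n (by omega)
  refine ⟨G, hG1, fun g hg => ?_⟩
  have hge : n ≤ G.edgeSet.ncard := by
    have hn0 : (0 : ℝ) ≤ n := Nat.cast_nonneg _
    have : (n : ℝ) ≤ G.edgeSet.ncard := by nlinarith
    exact_mod_cast this
  obtain ⟨a, w, hw, hl⟩ := SimpleGraph.exists_girth_eq_length.2
    (LargeGirth.not_acyclic (by omega) G hge)
  have hg' : G.girth = g := by exact_mod_cast hg
  rw [← hg', hl]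
  exact hG2 a w hw
end

section
/- Let G = (V, E) be a finite connected simple graph on n vertices with finite girth g, and let d_G be its shortest-path (graph) metric. Let (f, χ) be a clan embedding of (V, d_G) into a tree metric (Y, d_Y) with multiplicative distortion t for some t < g/4 − 3/2. Then Σ_{v∈V}|f(v)| ≥ n + χ(G), where χ(G) = |E| − |V| + 1 is the Euler characteristic of G. -/
namespace ClanAux

/-- total weight of a walk -/
def wsum {X A : Type*} [AddCommGroup A] {H : SimpleGraph X} (W : Sym2 X → A) {u v : X}
    (p : H.Walk u v) : A := (p.edges.map W).sum

section
variable {X A : Type*} [AddCommGroup A] {H : SimpleGraph X} (W : Sym2 X → A)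

@[simp] lemma wsum_nil {u : X} : wsum W (SimpleGraph.Walk.nil : H.Walk u u) = 0 := by
  simp [wsum]

@[simp] lemma wsum_cons {u v w : X} (h : H.Adj u v) (p : H.Walk v w) :
    wsum W (SimpleGraph.Walk.cons h p) = W s(u, v) + wsum W p := by
  simp [wsum]

@[simp] lemma wsum_append {u v w : X} (p : H.Walk u v) (q : H.Walk v w) :
    wsum W (p.append q) = wsum W p + wsum W q := by
  simp [wsum]

@[simp] lemma wsum_reverse {u v : X} (p : H.Walk u v) :
    wsum W p.reverse = wsum W p := by
  simp [wsum, List.sum_reverse]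

lemma path_edge {u v : X} (p : H.Walk v u) (hp : p.IsPath) (he : s(u, v) ∈ p.edges) :
    wsum W p = W s(u, v) := by
  cases p with
  | nil => simp at he
  | @cons _ x _ h r =>
    rw [SimpleGraph.Walk.cons_isPath_iff] at hp
    rw [SimpleGraph.Walk.edges_cons, List.mem_cons] at he
    rcases he with he | he
    · have hx : x = u := by
        have hvx := h.ne
        rw [Sym2.eq_iff] at he
        grind
      subst hx
      have := SimpleGraph.Walk.isPath_iff_eq_nil.mp hp.1
      subst this
      simp [Sym2.eq_swap]
    · exact absurd (r.snd_mem_support_of_mem_edges he) hp.2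

lemma wsum_bypass [DecidableEq X] (hA : ∀ a : A, a + a = 0) {u v : X} (p : H.Walk u v)
    (hc : ∀ x (q : H.Walk x x), q.IsCycle → p.length < q.length) :
    wsum W p = wsum W p.bypass := by
  induction p with
  | nil => simp [SimpleGraph.Walk.bypass]
  | @cons u v w h p ih =>
    have ih' := ih (fun x q hq => by
      have := hc x q hq
      rw [SimpleGraph.Walk.length_cons] at this
      omega)
    rw [wsum_cons, ih']
    simp only [SimpleGraph.Walk.bypass]
    split_ifs with hs
    · have hsplit : wsum W p.bypass
          = wsum W (p.bypass.takeUntil u hs) + wsum W (p.bypass.dropUntil u hs) := by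
        rw [← wsum_append, SimpleGraph.Walk.take_spec]
      have hpath : (p.bypass.takeUntil u hs).IsPath := p.bypass_isPath.takeUntil hs
      have he : s(u, v) ∈ (p.bypass.takeUntil u hs).edges := by
        by_contra hne
        have h1 := hc u _ ((SimpleGraph.Walk.cons_isCycle_iff _ h).mpr ⟨hpath, hne⟩)
        have h2 := p.bypass.length_takeUntil_le_length hs
        have h3 := p.length_bypass_le_length
        simp only [SimpleGraph.Walk.length_cons] at h1
        omega
      rw [hsplit, path_edge W _ hpath he, ← add_assoc, hA, zero_add]
    · rw [wsum_cons]

lemma wsum_closed (hA : ∀ a : A, a + a = 0) {u : X} (p : H.Walk u u)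
    (hc : ∀ x (q : H.Walk x x), q.IsCycle → p.length < q.length) :
    wsum W p = 0 := by
  classical
  rw [wsum_bypass W hA p hc, SimpleGraph.Walk.isPath_iff_eq_nil.mp p.bypass_isPath, wsum_nil]

end

lemma eq_of_add {A : Type*} [AddCommGroup A] (hA : ∀ a : A, a + a = 0) {a b : A}
    (h : a + b = 0) : a = b := by
  have := hA b
  exact add_right_cancel (h.trans this.symm)

lemma rank_bound {ι Y A : Type*} [Fintype ι] [AddCommGroup A] [Module (ZMod 2) A]
    (b : ι → A) (hb : LinearIndependent (ZMod 2) b) (Z : Finset Y) (hZ : Z.Nonempty)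
    (P : Y → A) (h : ∀ i, ∃ z ∈ Z, ∃ z' ∈ Z, P z - P z' = b i) :
    Fintype.card ι + 1 ≤ Z.card := by
  classical
  obtain ⟨z0, hz0⟩ := hZ
  let w : Finset A := (Z.erase z0).image (fun z => P z - P z0)
  have hw : ∀ z ∈ Z, P z - P z0 ∈ Submodule.span (ZMod 2) (w : Set A) := by
    intro z hz
    by_cases hzz : z = z0
    · subst hzz; simp
    · exact Submodule.subset_span (Finset.mem_coe.mpr
        (Finset.mem_image_of_mem _ (Finset.mem_erase.mpr ⟨hzz, hz⟩)))
  have h1 := linearIndependent_le_span_aux' b hb (w : Set A) (by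
    rintro _ ⟨i, rfl⟩
    obtain ⟨z, hz, z', hz', e⟩ := h i
    rw [← e, ← sub_sub_sub_cancel_right _ _ (P z0)]
    exact Submodule.sub_mem _ (hw z hz) (hw z' hz'))
  have h2 : w.card ≤ (Z.erase z0).card := Finset.card_image_le
  rw [Finset.card_erase_of_mem hz0] at h2
  have h3 : 0 < Z.card := Finset.card_pos.mpr ⟨z0, hz0⟩
  simp only [Finset.coe_sort_coe, Fintype.card_coe] at h1
  omega

end ClanAux

open ClanAux

/-- if a connected graph `G` with girth `g` admits a clan embedding of
its shortest-path metric into a tree metric with multiplicative distortion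
`t < g/4 − 3/2`, then the total clan size is at least `n + χ(G)` where
`χ(G) = |E| − |V| + 1`. -/
theorem clan_embedding_girth_lower_bound
    (V : Type*) [Fintype V] (G : SimpleGraph V) (hconn : G.Connected)
    (g : ℕ) (hg : G.girth = (g : ℕ∞))
    (Y : Type*) [MetricSpace Y] [Fintype Y] (hY : IsTreeMetric Y)
    (f : V → Finset Y) (χY : V → Y) (t : ℝ)
    (ht : t < (g : ℝ) / 4 - 3 / 2)
    (hne : ∀ v, (f v).Nonempty)
    (hdisj : ∀ u v : V, u ≠ v → Disjoint (f u) (f v))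
    (hdom : ∀ u v : V, u ≠ v → ∀ u' ∈ f u, ∀ v' ∈ f v, (G.dist u v : ℝ) ≤ dist u' v')
    (hchief : ∀ v, χY v ∈ f v)
    (hdistortion : ∀ u v : V, ∃ v' ∈ f v, dist v' (χY u) ≤ t * (G.dist u v : ℝ)) :
    (Fintype.card V : ℤ) + ((G.edgeSet.ncard : ℤ) - (Fintype.card V : ℤ) + 1) ≤
      ∑ v, ((f v).card : ℤ) := by
  classical
  have hg' : G.girth = g := by exact_mod_cast hg
  obtain ⟨v0⟩ := hconn.nonempty
  let Z : Finset Y := Finset.univ.biUnion f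
  have hZcard : Z.card = ∑ v, (f v).card :=
    Finset.card_biUnion (fun u _ v _ huv => hdisj u v huv)
  have hZne : Z.Nonempty :=
    ⟨χY v0, Finset.mem_biUnion.mpr ⟨v0, Finset.mem_univ _, hchief v0⟩⟩
  have memZ : ∀ v, ∀ z ∈ f v, z ∈ Z := fun v z hz =>
    Finset.mem_biUnion.mpr ⟨v, Finset.mem_univ _, hz⟩
  suffices hmain : Fintype.card G.edgeSet + 1 ≤ Z.card by
    rw [hZcard, ← Nat.card_eq_fintype_card] at hmain
    have h0 : (G.edgeSet.ncard + 1 : ℤ) ≤ ((∑ v, (f v).card : ℕ) : ℤ) := by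
      exact_mod_cast hmain
    push_cast at h0
    linarith
  by_cases hE : ∃ a b, G.Adj a b
  swap
  · have : IsEmpty G.edgeSet := by
      constructor
      rintro ⟨e, he⟩
      induction e using Sym2.ind with
      | _ a b => exact hE ⟨a, b, he⟩
    rw [Fintype.card_eq_zero, zero_add]
    exact Finset.card_pos.mpr hZne
  have ht1 : 1 ≤ t := by
    obtain ⟨a, b, hab⟩ := hE
    obtain ⟨b', hb', hd⟩ := hdistortion a b
    have h1 := hdom b a hab.ne' b' hb' _ (hchief a)
    rw [SimpleGraph.dist_eq_one_iff_adj.mpr hab] at hd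
    rw [SimpleGraph.dist_eq_one_iff_adj.mpr hab.symm] at h1
    push_cast at hd h1
    linarith
  have h3t : 3 * t < g := by linarith
  have hg3 : 3 < g := by
    have : (3 : ℝ) < g := by linarith
    exact_mod_cast this
  have hcyc : ∀ n, n < g → ∀ x (q : G.Walk x x), q.IsCycle → n < q.length := by
    intro n hn x q hq
    have := SimpleGraph.girth_le_length hq
    omega
  have hA : ∀ a : Sym2 V →₀ ZMod 2, a + a = 0 := fun a => by
    ext e
    simp [CharTwo.add_self_eq_zero]
  let S : Sym2 V → (Sym2 V →₀ ZMod 2) := fun e => Finsupp.single e 1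
  choose sp hsp using hconn.exists_walk_length_eq_dist
  let c : V → V → (Sym2 V →₀ ZMod 2) := fun a b => wsum S (sp a b)
  have htri : ∀ a b d, G.dist a b + G.dist b d + G.dist a d < g → c a b + c b d = c a d := by
    intro a b d h
    have h0 := wsum_closed S hA (((sp a b).append (sp b d)).append (sp a d).reverse)
      (hcyc _ (by simp only [SimpleGraph.Walk.length_append, SimpleGraph.Walk.length_reverse, hsp]
                  exact h))
    simp only [wsum_append, wsum_reverse] at h0
    exact eq_of_add hA h0
  have hself : ∀ a, c a a = 0 := by
    intro a
    exact wsum_closed S hA (sp a a) (hcyc _ (by rw [hsp, SimpleGraph.dist_self]; omega))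
  have hsymm : ∀ a b, 2 * G.dist a b < g → c a b = c b a := by
    intro a b h
    have h0 := htri a b a (by
      rw [SimpleGraph.dist_self, SimpleGraph.dist_comm (u := b) (v := a)]; omega)
    rw [hself] at h0
    exact eq_of_add hA h0
  have hadj : ∀ a b, G.Adj a b → c a b = S s(a, b) := by
    intro a b h
    have h0 := wsum_closed S hA (SimpleGraph.Walk.cons h.symm (sp a b))
      (hcyc _ (by
        rw [SimpleGraph.Walk.length_cons, hsp, SimpleGraph.dist_eq_one_iff_adj.mpr h]; omega))
    rw [wsum_cons] at h0
    rw [Sym2.eq_swap]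
    exact (eq_of_add hA h0).symm
  -- nearest point projection
  have hnear : ∀ y : Y, ∃ v, ∃ z ∈ f v, ∀ v', ∀ z' ∈ f v', dist y z ≤ dist y z' := by
    intro y
    obtain ⟨z, hz, hmin⟩ := Finset.exists_min_image Z (fun z => dist y z) hZne
    obtain ⟨v, -, hv⟩ := Finset.mem_biUnion.mp hz
    exact ⟨v, z, hv, fun v' z' hz' => hmin z' (memZ v' z' hz')⟩
  choose φ ζ hζ hmin using hnear
  have hφ : ∀ v, ∀ z ∈ f v, φ z = v := by
    intro v z hz
    have h0 := hmin z v z hz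
    rw [dist_self] at h0
    have h1 : z = ζ z := dist_le_zero.mp h0
    by_contra hne'
    have h2 := hζ z
    rw [← h1] at h2
    exact Finset.disjoint_left.mp (hdisj _ _ hne') h2 hz
  have hdG : ∀ y y', (G.dist (φ y) (φ y') : ℝ) ≤ dist (ζ y) (ζ y') := by
    intro y y'
    by_cases h : φ y = φ y'
    · rw [h, SimpleGraph.dist_self]
      simp
    · exact hdom _ _ h _ (hζ y) _ (hζ y')
  obtain ⟨T, w, hT, hw, hd⟩ := hY
  let W : Sym2 Y → (Sym2 V →₀ ZMod 2) := fun e => c (φ (Quot.out e).1) (φ (Quot.out e).2)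
  have hW : ∀ y y', 2 * G.dist (φ y) (φ y') < g → W s(y, y') = c (φ y) (φ y') := by
    intro y y' h
    have h0 : s((Quot.out s(y, y')).1, (Quot.out s(y, y')).2) = s(y, y') := Quot.out_eq s(y, y')
    rw [Sym2.eq_iff] at h0
    simp only [W]
    rcases h0 with ⟨h1, h2⟩ | ⟨h1, h2⟩
    · rw [h1, h2]
    · rw [h1, h2, hsymm _ _ h]
  have key : ∀ (y z : Y) (q : T.Walk y z), q.IsPath → (∃ v, z ∈ f v) →
      dist y (ζ y) + dist y z ≤ t → wsum W q = c (φ y) (φ z) := by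
    intro y z q
    induction q with
    | nil => intro _ _ _; rw [wsum_nil, hself]
    | @cons y y1 z h q ih =>
      intro hp hz ht'
      obtain ⟨v, hv⟩ := hz
      have hp' := (SimpleGraph.Walk.cons_isPath_iff h q).mp hp
      have hdz : dist y z = dist y y1 + dist y1 z := by
        rw [hd y z _ hp, hd y1 z q hp'.1,
          hd y y1 (SimpleGraph.Walk.cons h SimpleGraph.Walk.nil) (by
            rw [SimpleGraph.Walk.cons_isPath_iff]; simp [h.ne])]
        simp
      have hr1 : dist y1 (ζ y1) ≤ dist y y1 + dist y (ζ y) :=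
        (hmin y1 _ _ (hζ y)).trans (by
          have := dist_triangle y1 y (ζ y)
          rw [dist_comm y1 y] at this
          exact this)
      have hr2 : dist y1 (ζ y1) ≤ dist y1 z := hmin y1 v z hv
      have hζz : ζ z = z := by
        have h0 := hmin z v z hv
        rw [dist_self] at h0
        exact (dist_le_zero.mp h0).symm
      have e1 : (G.dist (φ y) (φ z) : ℝ) ≤ t := by
        have a1 := hdG y z
        rw [hζz] at a1
        have a2 := dist_triangle (ζ y) y z
        rw [dist_comm (ζ y) y] at a2
        linarith
      have e2 : (G.dist (φ y1) (φ z) : ℝ) ≤ t := by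
        have a1 := hdG y1 z
        rw [hζz] at a1
        have a2 := dist_triangle (ζ y1) y1 z
        rw [dist_comm (ζ y1) y1] at a2
        linarith
      have e3 : (G.dist (φ y) (φ y1) : ℝ) ≤ t := by
        have a1 := hdG y y1
        have a2 := dist_triangle4 (ζ y) y y1 (ζ y1)
        rw [dist_comm (ζ y) y] at a2
        linarith
      have b1 : G.dist (φ y) (φ y1) + G.dist (φ y1) (φ z) + G.dist (φ y) (φ z) < g := by
        have : ((G.dist (φ y) (φ y1) + G.dist (φ y1) (φ z) + G.dist (φ y) (φ z) : ℕ) : ℝ) < g := by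
          push_cast
          linarith
        exact_mod_cast this
      have b2 : 2 * G.dist (φ y) (φ y1) < g := by
        have : ((2 * G.dist (φ y) (φ y1) : ℕ) : ℝ) < g := by
          push_cast
          linarith
        exact_mod_cast this
      rw [wsum_cons, hW _ _ b2, ih hp'.1 ⟨v, hv⟩ (by linarith), htri _ _ _ b1]
  -- potential on the tree
  choose tp htp using fun y => (hT.1.preconnected (χY v0) y).exists_isPath
  have hTc : ∀ n, ∀ x (q : T.Walk x x), q.IsCycle → n < q.length :=
    fun n x q hq => absurd hq (hT.2 q)
  refine rank_bound (fun e : G.edgeSet => S e.1) ?_ Z hZne (fun y => wsum W (tp y)) ?_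
  · exact (Finsupp.linearIndependent_single_one (ZMod 2) (Sym2 V)).comp _ Subtype.val_injective
  · rintro ⟨e, he⟩
    induction e using Sym2.ind with
    | _ a b =>
      have hab : G.Adj a b := he
      obtain ⟨b', hb', hdb⟩ := hdistortion a b
      rw [SimpleGraph.dist_eq_one_iff_adj.mpr hab] at hdb
      refine ⟨χY a, memZ _ _ (hchief a), b', memZ _ _ hb', ?_⟩
      obtain ⟨q, hq⟩ := (hT.1.preconnected (χY a) b').exists_isPath
      have hk := key _ _ q hq ⟨b, hb'⟩ (by
        have h0 := hmin (χY a) a _ (hchief a)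
        rw [dist_self] at h0
        rw [dist_comm b'] at hdb
        push_cast at hdb
        linarith)
      rw [hφ a _ (hchief a), hφ b _ hb', hadj _ _ hab] at hk
      have hcl := wsum_closed W hA (((tp (χY a)).append q).append (tp b').reverse) (hTc _)
      simp only [wsum_append, wsum_reverse] at hcl
      have h1 := eq_of_add hA hcl
      rw [hk] at h1
      have h2 := hA (S s(a, b))
      show wsum W (tp (χY a)) - wsum W (tp b') = S s(a, b)
      rw [← h1, sub_add_cancel_left]
      exact neg_eq_of_add_eq_zero_left h2
end

section
/- There is a universal constant C > 0 such that the following holds. Let G = (V, E, w) be a weighted graph on n ≥ 2 vertices, let μ be a (≥1)-measure on V, and let k ≥ 1 be an integer. Then there exists a spanning clan embedding (f, χ) of G into a tree with multiplicative distortion at most C·k·(1 + log₂ log₂ μ(V)) such that Σ_{v∈V} μ(v)·|f(v)| ≤ μ(V)^{1+1/k}. -/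
/-- The shortest-path metric of a weighted graph: the infimum of the total edge weight of
walks from `u` to `v`. -/
noncomputable def spDist {V : Type*} (G : SimpleGraph V) (w : Sym2 V → ℝ) (u v : V) : ℝ :=
  sInf (Set.range fun p : G.Walk u v => (p.edges.map w).sum)

/-- `(f, χ)` is a spanning clan embedding of the weighted graph `(G, wG)` into the
weighted tree `(T, wT)` with multiplicative distortion `t`:
`T` is a tree with positive edge weights whose vertex set is the union of the clans;
clans are nonempty and pairwise disjoint; every tree edge joins copies of adjacent
vertices of `G` and carries the same weight; the embedding is dominating; `χ v` is a
member of the clan of `v`; and for all `u v` some copy of `v` is within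
`t·d_G(u,v)` of the chief `χ u` in the tree metric. -/
def IsSpanningClanTree {V Y : Type*}
    (G : SimpleGraph V) (wG : Sym2 V → ℝ)
    (T : SimpleGraph Y) (wT : Sym2 Y → ℝ)
    (f : V → Finset Y) (χ : V → Y) (t : ℝ) : Prop :=
  T.IsTree ∧
  (∀ e ∈ T.edgeSet, 0 < wT e) ∧
  (∀ v, (f v).Nonempty) ∧
  (∀ u v : V, u ≠ v → Disjoint (f u) (f v)) ∧
  (∀ y : Y, ∃ v : V, y ∈ f v) ∧
  (∀ (u v : V) (u' v' : Y), u' ∈ f u → v' ∈ f v → T.Adj u' v' →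
      G.Adj u v ∧ wT s(u', v') = wG s(u, v)) ∧
  (∀ u v : V, u ≠ v → ∀ u' ∈ f u, ∀ v' ∈ f v, spDist G wG u v ≤ spDist T wT u' v') ∧
  (∀ v, χ v ∈ f v) ∧
  (∀ u v : V, ∃ v' ∈ f v, spDist T wT v' (χ u) ≤ t * spDist G wG u v)

/-! ### Basic facts about `spDist` -/

section Basic

variable {V : Type} {G : SimpleGraph V} {w : Sym2 V → ℝ}

/-- Length of a walk. -/
def plen {V : Type} {G : SimpleGraph V} (w : Sym2 V → ℝ) {u v : V} (p : G.Walk u v) : ℝ :=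
  (p.edges.map w).sum

lemma plen_nonneg (hw : ∀ e ∈ G.edgeSet, 0 < w e) {u v : V} (p : G.Walk u v) : 0 ≤ plen w p := by
  unfold plen
  apply List.sum_nonneg
  intro x hx
  simp only [List.mem_map] at hx
  obtain ⟨e, he, rfl⟩ := hx
  exact (hw e (p.edges_subset_edgeSet he)).le

lemma sp_bdd (hw : ∀ e ∈ G.edgeSet, 0 < w e) (u v : V) :
    BddBelow (Set.range fun p : G.Walk u v => (p.edges.map w).sum) :=
  ⟨0, by rintro _ ⟨p, rfl⟩; exact plen_nonneg hw p⟩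

lemma sp_le_plen (hw : ∀ e ∈ G.edgeSet, 0 < w e) {u v : V} (p : G.Walk u v) :
    spDist G w u v ≤ plen w p :=
  csInf_le (sp_bdd hw u v) ⟨p, rfl⟩

lemma le_sp (hG : G.Connected) {u v : V} {x : ℝ} (h : ∀ p : G.Walk u v, x ≤ plen w p) :
    x ≤ spDist G w u v := by
  obtain ⟨p⟩ := hG.preconnected u v
  exact le_csInf ⟨_, p, rfl⟩ (by rintro _ ⟨p, rfl⟩; exact h p)

lemma sp_nonneg (hw : ∀ e ∈ G.edgeSet, 0 < w e) (u v : V) : 0 ≤ spDist G w u v :=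
  Real.sInf_nonneg (by rintro _ ⟨p, rfl⟩; exact plen_nonneg hw p)

lemma sp_self (hw : ∀ e ∈ G.edgeSet, 0 < w e) (u : V) : spDist G w u u = 0 :=
  le_antisymm (by simpa [plen] using sp_le_plen hw (SimpleGraph.Walk.nil : G.Walk u u))
    (sp_nonneg hw u u)

lemma sp_lip (hG : G.Connected) (f : V → ℝ)
    (hf : ∀ a b, G.Adj a b → f b ≤ f a + w s(a, b)) (u v : V) :
    f v ≤ f u + spDist G w u v := by
  suffices f v - f u ≤ spDist G w u v by linarith
  apply le_sp hG
  intro p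
  induction p with
  | nil => simp [plen]
  | cons h p ih =>
    have := hf _ _ h
    simp only [plen, SimpleGraph.Walk.edges_cons, List.map_cons, List.sum_cons] at ih ⊢
    linarith

lemma sp_adj (hw : ∀ e ∈ G.edgeSet, 0 < w e) {u v : V} (h : G.Adj u v) :
    spDist G w u v ≤ w s(u, v) := by
  simpa [plen] using sp_le_plen hw h.toWalk

lemma sp_comm (u v : V) : spDist G w u v = spDist G w v u := by
  unfold spDist
  congr 1
  ext x
  constructor
  · rintro ⟨p, rfl⟩; exact ⟨p.reverse, by simp⟩
  · rintro ⟨p, rfl⟩; exact ⟨p.reverse, by simp⟩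

lemma plen_append {u v x : V} (p : G.Walk u v) (q : G.Walk v x) :
    plen w (p.append q) = plen w p + plen w q := by
  simp [plen]

lemma sp_tri (hG : G.Connected) (hw : ∀ e ∈ G.edgeSet, 0 < w e) (u v x : V) :
    spDist G w u x ≤ spDist G w u v + spDist G w v x := by
  have h1 : ∀ p : G.Walk u v, spDist G w u x - plen w p ≤ spDist G w v x := by
    intro p
    apply le_sp hG
    intro q
    have := sp_le_plen hw (p.append q)
    rw [plen_append] at this
    linarith
  have h2 : spDist G w u x - spDist G w v x ≤ spDist G w u v := by
    apply le_sp hG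
    intro p
    linarith [h1 p]
  linarith

lemma sp_last [Finite V] (hG : G.Connected) (hw : ∀ e ∈ G.edgeSet, 0 < w e) {u v : V} (h : u ≠ v) :
    ∃ a, G.Adj a v ∧ spDist G w u v = spDist G w u a + w s(a, v) := by
  have hne : {a | G.Adj a v}.Nonempty := by
    obtain ⟨p⟩ := hG.preconnected v u
    cases p with
    | nil => exact absurd rfl h
    | cons h p => exact ⟨_, h.symm⟩
  obtain ⟨a, ha, hmin⟩ := (Set.toFinite {a | G.Adj a v}).exists_minimalFor
    (fun a => spDist G w u a + w s(a, v)) _ hne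
  refine ⟨a, ha, le_antisymm ?_ ?_⟩
  · have := sp_adj hw ha
    linarith [sp_tri hG hw u a v]
  · apply le_sp hG
    intro p
    have : ∃ c, ∃ hc : G.Adj c v, ∃ q : G.Walk u c, plen w p = plen w q + w s(c, v) := by
      clear hmin ha
      obtain ⟨c, hc, q, hq⟩ : ∃ c, ∃ hc : G.Adj v c, ∃ q : G.Walk c u,
          p.reverse = SimpleGraph.Walk.cons hc q := by
        cases hp : p.reverse with
        | nil => exact absurd rfl h
        | cons h q => exact ⟨_, h, q, rfl⟩
      refine ⟨c, hc.symm, q.reverse, ?_⟩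
      have : p = (SimpleGraph.Walk.cons hc q).reverse := by rw [← hq]; simp
      rw [this]
      simp [plen]
    obtain ⟨c, hc, q, hq⟩ := this
    have h1 := sp_le_plen hw q
    rw [hq]
    by_contra! hlt
    have hlt2 : spDist G w u c + w s(c, v) < spDist G w u a + w s(a, v) := by linarith
    have := hmin hc hlt2.le
    simp only at this
    linarith

lemma sp_pos [Finite V] (hG : G.Connected) (hw : ∀ e ∈ G.edgeSet, 0 < w e) {u v : V}
    (h : u ≠ v) : 0 < spDist G w u v := by
  obtain ⟨a, ha, e⟩ := sp_last hG hw h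
  rw [e]
  have := hw s(a, v) ha
  linarith [sp_nonneg hw u a]

/-- Strong induction along a real-valued function on a finite type. -/
lemma real_induction [Finite V] (g : V → ℝ) (Q : V → Prop)
    (h : ∀ v, (∀ a, g a < g v → Q a) → Q v) (v : V) : Q v := by
  have wf : WellFounded (fun a b : V => g a < g b) := by
    have : IsTrans V (fun a b : V => g a < g b) := ⟨fun a b c h1 h2 => lt_trans h1 h2⟩
    have : Std.Irrefl (fun a b : V => g a < g b) := ⟨fun a => lt_irrefl _⟩
    exact Finite.wellFounded_of_trans_of_irrefl _
  exact wf.induction v h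

/-- Restriction of weights to a subset. -/
def wres (S : Set V) (w : Sym2 V → ℝ) : Sym2 S → ℝ := fun e => w (e.map Subtype.val)

lemma wres_pos (S : Set V) (hw : ∀ e ∈ G.edgeSet, 0 < w e) :
    ∀ e ∈ (G.induce S).edgeSet, 0 < wres S w e := by
  intro e
  induction e with
  | h a b => intro h; exact hw s(a.1, b.1) h

lemma interval_walk [Finite V] (hG : G.Connected) (hw : ∀ e ∈ G.edgeSet, 0 < w e) (S : Set V)
    (u : S) (v : V) (hv : v ∈ S)
    (h : ∀ y, spDist G w u y + spDist G w y v = spDist G w u v → y ∈ S) :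
    ∃ p : (G.induce S).Walk u ⟨v, hv⟩, plen (wres S w) p ≤ spDist G w u v := by
  revert hv h
  refine real_induction (fun v => spDist G w u v) (fun v => ∀ (hv : v ∈ S),
    (∀ y, spDist G w u y + spDist G w y v = spDist G w u v → y ∈ S) →
    ∃ p : (G.induce S).Walk u ⟨v, hv⟩, plen (wres S w) p ≤ spDist G w u v) ?_ v
  intro v ih hv h
  by_cases huv : u.1 = v
  · subst huv
    exact ⟨SimpleGraph.Walk.nil, by simpa [plen] using sp_nonneg hw _ _⟩
  obtain ⟨a, ha, e⟩ := sp_last hG hw huv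
  have hpos := hw s(a, v) ha
  have h1 := sp_adj hw ha
  have h2 := sp_tri hG hw u a v
  have haS : a ∈ S := h a (by linarith)
  obtain ⟨p, hp⟩ := ih a (by linarith) haS (by
    intro y hy
    apply h
    have h3 := sp_tri hG hw y a v
    have h4 := sp_tri hG hw u y v
    linarith)
  have hav : (G.induce S).Adj ⟨a, haS⟩ ⟨v, hv⟩ := ha
  refine ⟨p.append hav.toWalk, ?_⟩
  rw [plen_append, e]
  have : plen (wres S w) hav.toWalk = w s(a, v) := by simp [plen, wres]
  linarith

lemma sp_res_ge [Finite V] (hG : G.Connected) (hw : ∀ e ∈ G.edgeSet, 0 < w e) (S : Set V)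
    (hS : (G.induce S).Connected) (u v : S) :
    spDist G w u v ≤ spDist (G.induce S) (wres S w) u v := by
  have := sp_lip (w := wres S w) hS (fun v => spDist G w u v) (by
    intro a b hab
    have hab' : G.Adj a.1 b.1 := hab
    have h1 := sp_adj hw hab'
    have h2 := sp_tri hG hw u a b
    simp only [wres, Sym2.map_mk]
    linarith) u v
  simp only [sp_self hw] at this
  linarith

lemma plen_mono {w' : Sym2 V → ℝ} (h : ∀ e ∈ G.edgeSet, w' e ≤ w e) {u v : V} (p : G.Walk u v) :
    plen w' p ≤ plen w p := by
  unfold plen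
  apply List.sum_le_sum
  intro e he
  exact h e (p.edges_subset_edgeSet he)

lemma sp_map {V' : Type} {G' : SimpleGraph V'} {w' : Sym2 V' → ℝ}
    (hG : G.Connected) (hG' : G'.Connected) (hw' : ∀ e ∈ G'.edgeSet, 0 < w' e) (φ : V → V')
    (hφ : ∀ a b, G.Adj a b → G'.Adj (φ a) (φ b) ∧ w' s(φ a, φ b) ≤ w s(a, b)) (u v : V) :
    spDist G' w' (φ u) (φ v) ≤ spDist G w u v := by
  have := sp_lip (w := w) hG (fun v => spDist G' w' (φ u) (φ v)) (by
    intro a b hab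
    obtain ⟨h0, h3⟩ := hφ a b hab
    have h1 := sp_adj hw' h0
    have h2 := sp_tri hG' hw' (φ u) (φ a) (φ b)
    linarith) u v
  simp only [sp_self hw'] at this
  linarith

end Basic

/-! ### Choosing the cut -/

lemma choose_cut (κ : ℝ) (hκ : 0 < κ) (L : ℕ) (hL : 1 ≤ L) (M m : ℝ) (hmM : m ≤ M)
    (hM : Real.logb 2 M ≤ (1 + κ) ^ L) (a : ℕ → ℝ)
    (ha1 : ∀ i ≤ 2 * L, 1 ≤ a i) (ha2 : ∀ i ≤ 2 * L, 1 ≤ m - a i) :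
    ∃ i < 2 * L, a (i + 1) ^ (1 + κ) + (m - a i) ^ (1 + κ) ≤ m ^ (1 + κ) := by
  have hm : 0 < m := by linarith [ha1 0 (by omega), ha2 0 (by omega)]
  have h1κ : 0 < 1 + κ := by linarith
  have hlog2 : 0 < Real.log 2 := Real.log_pos (by norm_num)
  have hlogm : Real.log m ≤ Real.log 2 * (1 + κ) ^ L := by
    have h1 : Real.log m ≤ Real.log M := Real.log_le_log hm hmM
    have h2 : Real.log M ≤ Real.log 2 * (1 + κ) ^ L := by
      rw [Real.logb, div_le_iff₀ hlog2] at hM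
      linarith
    linarith
  by_contra! hcon
  have mpow : m ^ (1 + κ) = m * m ^ κ := by rw [Real.rpow_add hm, Real.rpow_one]
  have sub : ∀ x, 0 < x → x ≤ m → x ^ (1 + κ) ≤ x * m ^ κ := by
    intro x hx hxm
    rw [Real.rpow_add hx, Real.rpow_one]
    exact mul_le_mul_of_nonneg_left (Real.rpow_le_rpow hx.le hxm hκ.le) hx.le
  have F1 : ∀ i < 2 * L, (1 + κ) * (Real.log m - Real.log (a (i+1))) <
      Real.log m - Real.log (a i) := by
    intro i hi
    have hc := hcon i hi
    have p1 := ha1 i hi.le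
    have p2 := ha2 i hi.le
    have p3 := ha1 (i+1) hi
    have h1 := sub (m - a i) (by linarith) (by linarith)
    have h2 : a i * m ^ κ < a (i+1) ^ (1 + κ) := by
      rw [mpow] at hc; nlinarith
    have h3 := Real.log_lt_log (by positivity) h2
    rw [Real.log_mul (by linarith) (by positivity), Real.log_rpow hm, Real.log_rpow (by linarith)]
      at h3
    linarith
  have F2 : ∀ i < 2 * L, (1 + κ) * (Real.log m - Real.log (m - a i)) <
      Real.log m - Real.log (m - a (i+1)) := by
    intro i hi
    have hc := hcon i hi
    have p1 := ha1 i hi.le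
    have p2 := ha2 i hi.le
    have p3 := ha1 (i+1) hi
    have p4 := ha2 (i+1) hi
    have h1 := sub (a (i+1)) (by linarith) (by linarith)
    have h2 : (m - a (i+1)) * m ^ κ < (m - a i) ^ (1 + κ) := by
      rw [mpow] at hc; nlinarith
    have h3 := Real.log_lt_log (by positivity) h2
    rw [Real.log_mul (by linarith) (by positivity), Real.log_rpow hm, Real.log_rpow (by linarith)]
      at h3
    linarith
  rcases le_total (a L) (m / 2) with hhalf | hhalf
  · have key : ∀ i, i + 1 ≤ L → (1 + κ) ^ (i+1) * (Real.log m - Real.log (a (i+1))) <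
        Real.log m - Real.log (a 0) := by
      intro i
      induction i with
      | zero => intro _; simpa using F1 0 (by omega)
      | succ i ih =>
        intro hi
        have h1 := ih (by omega)
        have h2 := mul_lt_mul_of_pos_left (F1 (i+1) (by omega)) (pow_pos h1κ (i+1))
        calc _ = (1 + κ) ^ (i+1) * ((1 + κ) * (Real.log m - Real.log (a (i+1+1)))) := by ring
          _ < _ := h2.trans h1
    have h1 := key (L - 1) (by omega)
    rw [Nat.sub_add_cancel hL] at h1
    have h2 : Real.log (a L) ≤ Real.log m - Real.log 2 := by
      rw [← Real.log_div (by linarith) (by norm_num)]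
      exact Real.log_le_log (by linarith [ha1 L (by omega)]) hhalf
    have h3 : 0 ≤ Real.log (a 0) := Real.log_nonneg (ha1 0 (by omega))
    have h4 : (1 + κ) ^ L * Real.log 2 ≤ (1 + κ) ^ L * (Real.log m - Real.log (a L)) :=
      mul_le_mul_of_nonneg_left (by linarith) (by positivity)
    linarith
  · have key : ∀ i, i + 1 ≤ L → (1 + κ) ^ (i+1) * (Real.log m - Real.log (m - a L)) <
        Real.log m - Real.log (m - a (L + (i+1))) := by
      intro i
      induction i with
      | zero => intro _; simpa using F2 L (by omega)
      | succ i ih =>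
        intro hi
        have h1 := mul_lt_mul_of_pos_left (ih (by omega)) h1κ
        have h2 := F2 (L + (i+1)) (by omega)
        calc _ = (1 + κ) * ((1 + κ) ^ (i+1) * (Real.log m - Real.log (m - a L))) := by ring
          _ < _ := h1.trans h2
    have h1 := key (L - 1) (by omega)
    rw [Nat.sub_add_cancel hL] at h1
    have h2 : Real.log (m - a L) ≤ Real.log m - Real.log 2 := by
      rw [← Real.log_div (by linarith) (by norm_num)]
      exact Real.log_le_log (by linarith [ha2 L (by omega)]) (by linarith)
    have h3 : 0 ≤ Real.log (m - a (L+L)) := Real.log_nonneg (ha2 (L+L) (by omega))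
    have h4 : (1 + κ) ^ L * Real.log 2 ≤ (1 + κ) ^ L * (Real.log m - Real.log (m - a L)) :=
      mul_le_mul_of_nonneg_left (by linarith) (by positivity)
    linarith

/-! ### Trees with a projection to the graph, and gluing -/

lemma tree_glue {A B : Type} [Finite A] [Finite B] {S : SimpleGraph A} {T : SimpleGraph B}
    (hS : S.IsTree) (hT : T.IsTree) (a : A) (b : B) :
    (S.sum T ⊔ SimpleGraph.edge (Sum.inl a) (Sum.inr b)).IsTree := by
  rw [SimpleGraph.isTree_iff_connected_and_card] at hS hT ⊢
  refine ⟨hS.1.sum_sup_edge hT.1, ?_⟩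
  have h1 : Nat.card (S.sum T).edgeSet = Nat.card S.edgeSet + Nat.card T.edgeSet := by
    rw [Nat.card_congr SimpleGraph.edgeSetSumEquiv, Nat.card_sum]
  rw [Nat.card_sum, SimpleGraph.edgeSet_sup, SimpleGraph.edgeSet_edge_of_ne (by simp)]
  have h2 : Nat.card ((S.sum T).edgeSet ∪ {s(Sum.inl a, Sum.inr b)} : Set (Sym2 (A ⊕ B))) =
      Nat.card (S.sum T).edgeSet + 1 := by
    rw [Nat.card_coe_set_eq, Nat.card_coe_set_eq, Set.union_singleton, Set.ncard_insert_of_notMem]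
    simp
  rw [h2, h1]
  omega

/-- A finite tree with a graph homomorphism to `G`, a root, and a section. -/
structure Clan {V : Type} (G : SimpleGraph V) where
  Y : Type
  fin : Fintype Y
  T : SimpleGraph Y
  tree : T.IsTree
  pr : Y → V
  hom : ∀ a b, T.Adj a b → G.Adj (pr a) (pr b)
  root : Y
  chief : V → Y
  pr_chief : ∀ v, pr (chief v) = v

attribute [instance] Clan.fin

namespace Clan

variable {V : Type} {G : SimpleGraph V}

/-- Tree distance. -/
noncomputable def D (c : Clan G) (w : Sym2 V → ℝ) (a b : c.Y) : ℝ :=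
  spDist c.T (fun e => w (e.map c.pr)) a b

lemma wpos (c : Clan G) {w : Sym2 V → ℝ} (hw : ∀ e ∈ G.edgeSet, 0 < w e) :
    ∀ e ∈ c.T.edgeSet, 0 < (fun e => w (e.map c.pr)) e := by
  intro e
  induction e with
  | h a b => intro h; exact hw s(c.pr a, c.pr b) (c.hom _ _ h)

lemma D_tri (c : Clan G) {w : Sym2 V → ℝ} (hw : ∀ e ∈ G.edgeSet, 0 < w e) (a b x : c.Y) :
    c.D w a x ≤ c.D w a b + c.D w b x :=
  sp_tri c.tree.connected (c.wpos hw) _ _ _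

lemma D_comm (c : Clan G) {w : Sym2 V → ℝ} (a b : c.Y) : c.D w a b = c.D w b a :=
  sp_comm _ _

open Classical in
/-- Glue two clans along an edge. -/
noncomputable def glue {S₀ S₁ : Set V} (c₀ : Clan (G.induce S₀)) (c₁ : Clan (G.induce S₁))
    (ya : c₀.Y) (hadj : G.Adj (c₀.pr ya).1 (c₁.pr c₁.root).1) (A : Set V)
    (h₁ : ∀ v, v ∈ A → v ∈ S₁) (h₀ : ∀ v, v ∉ A → v ∈ S₀) : Clan G where
  Y := c₀.Y ⊕ c₁.Y
  fin := inferInstance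
  T := c₀.T.sum c₁.T ⊔ SimpleGraph.edge (Sum.inl ya) (Sum.inr c₁.root)
  tree := tree_glue c₀.tree c₁.tree _ _
  pr := Sum.elim (fun y => (c₀.pr y).1) (fun y => (c₁.pr y).1)
  hom := by
    rintro (a | a) (b | b) h
    · have : c₀.T.Adj a b := by simpa [SimpleGraph.edge_adj] using h
      exact c₀.hom _ _ this
    · have : a = ya ∧ b = c₁.root := by simpa [SimpleGraph.edge_adj] using h
      rw [this.1, this.2]; exact hadj
    · have : a = c₁.root ∧ b = ya := by
        have := by simpa [SimpleGraph.edge_adj] using h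
        tauto
      rw [this.1, this.2]; exact hadj.symm
    · have : c₁.T.Adj a b := by simpa [SimpleGraph.edge_adj] using h
      exact c₁.hom _ _ this
  root := Sum.inl c₀.root
  chief := fun v => if h : v ∈ A then Sum.inr (c₁.chief ⟨v, h₁ v h⟩)
    else Sum.inl (c₀.chief ⟨v, h₀ v h⟩)
  pr_chief := by
    intro v
    by_cases h : v ∈ A
    · simp [h, c₁.pr_chief]
    · simp [h, c₀.pr_chief]

section glue

variable {w : Sym2 V → ℝ} (hw : ∀ e ∈ G.edgeSet, 0 < w e)
  {S₀ S₁ : Set V} (c₀ : Clan (G.induce S₀)) (c₁ : Clan (G.induce S₁))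
    (ya : c₀.Y) (hadj : G.Adj (c₀.pr ya).1 (c₁.pr c₁.root).1) (A : Set V)
    (h₁ : ∀ v, v ∈ A → v ∈ S₁) (h₀ : ∀ v, v ∉ A → v ∈ S₀)

include hw

lemma glue_inl (a b : c₀.Y) :
    (glue c₀ c₁ ya hadj A h₁ h₀).D w (Sum.inl a) (Sum.inl b) ≤ c₀.D (wres S₀ w) a b := by
  refine sp_map c₀.tree.connected (glue c₀ c₁ ya hadj A h₁ h₀).tree.connected
    (wpos _ hw) Sum.inl ?_ a b
  intro a b hab
  refine ⟨by simp [glue, hab], le_of_eq rfl⟩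

lemma glue_inr (a b : c₁.Y) :
    (glue c₀ c₁ ya hadj A h₁ h₀).D w (Sum.inr a) (Sum.inr b) ≤ c₁.D (wres S₁ w) a b := by
  refine sp_map c₁.tree.connected (glue c₀ c₁ ya hadj A h₁ h₀).tree.connected
    (wpos _ hw) Sum.inr ?_ a b
  intro a b hab
  refine ⟨by simp [glue, hab], le_of_eq rfl⟩

lemma glue_edge :
    (glue c₀ c₁ ya hadj A h₁ h₀).D w (Sum.inl ya) (Sum.inr c₁.root) ≤
      w s((c₀.pr ya).1, (c₁.pr c₁.root).1) := by
  refine sp_adj (wpos _ hw) ?_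
  simp [glue, SimpleGraph.edge_adj]

lemma glue_root_inr (b : c₁.Y) :
    (glue c₀ c₁ ya hadj A h₁ h₀).D w (Sum.inl c₀.root) (Sum.inr b) ≤
      c₀.D (wres S₀ w) c₀.root ya + w s((c₀.pr ya).1, (c₁.pr c₁.root).1)
        + c₁.D (wres S₁ w) c₁.root b := by
  have h1 := glue_inl hw c₀ c₁ ya hadj A h₁ h₀ c₀.root ya
  have h2 := glue_inr hw c₀ c₁ ya hadj A h₁ h₀ c₁.root b
  have h3 := glue_edge hw c₀ c₁ ya hadj A h₁ h₀
  have h4 := (glue c₀ c₁ ya hadj A h₁ h₀).D_tri hw (Sum.inl c₀.root) (Sum.inl ya) (Sum.inr b)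
  have h5 := (glue c₀ c₁ ya hadj A h₁ h₀).D_tri hw (Sum.inl ya) (Sum.inr c₁.root) (Sum.inr b)
  linarith

end glue

end Clan

/-! ### Geodesic sets and petals -/

/-- `P` is the vertex set of a geodesic path starting at `x0`. -/
def Geo {V : Type} (G : SimpleGraph V) (w : Sym2 V → ℝ) (x0 : V) (P : Set V) : Prop :=
  x0 ∈ P ∧
  (∀ p ∈ P, ∀ q ∈ P, spDist G w x0 q ≤ spDist G w x0 p →
    spDist G w x0 q + spDist G w q p = spDist G w x0 p) ∧
  (∀ p ∈ P, ∀ q ∈ P, spDist G w x0 q < spDist G w x0 p →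
    ∃ a ∈ P, G.Adj a p ∧ spDist G w x0 p = spDist G w x0 a + w s(a, p) ∧
      spDist G w x0 q ≤ spDist G w x0 a)

/-- The petal of radius `r` around `t`, along the geodesic set `Q`. -/
def Petal {V : Type} (G : SimpleGraph V) (w : Sym2 V → ℝ) (x0 : V) (Q : Set V) (t : V) (r : ℝ) :
    Set V :=
  {z | ∃ p ∈ Q, spDist G w p t ≤ r ∧
    spDist G w x0 p + spDist G w p z - spDist G w x0 z ≤ (r - spDist G w p t) / 2}

section Petals

variable {V : Type} [Finite V] {G : SimpleGraph V} {w : Sym2 V → ℝ}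
  (hG : G.Connected) (hw : ∀ e ∈ G.edgeSet, 0 < w e)

include hG hw

lemma exists_geo (x0 t : V) :
    ∃ P, Geo G w x0 P ∧ t ∈ P ∧ ∀ p ∈ P, spDist G w x0 p ≤ spDist G w x0 t := by
  refine real_induction (fun t => spDist G w x0 t) (fun t => ∃ P, Geo G w x0 P ∧ t ∈ P ∧
    ∀ p ∈ P, spDist G w x0 p ≤ spDist G w x0 t) ?_ t
  intro t ih
  by_cases h : x0 = t
  · subst h
    refine ⟨{x0}, ⟨rfl, ?_, ?_⟩, rfl, ?_⟩
    · rintro p rfl q rfl _; simp [sp_self hw]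
    · rintro p rfl q rfl h; exact absurd h (lt_irrefl _)
    · rintro p rfl; exact le_rfl
  obtain ⟨a, ha, e⟩ := sp_last hG hw h
  have hpos := hw s(a, t) ha
  have hat := sp_adj hw ha
  obtain ⟨P, ⟨g0, g1, g2⟩, haP, hmax⟩ := ih a (by linarith)
  refine ⟨insert t P, ⟨Or.inr g0, ?_, ?_⟩, Or.inl rfl, ?_⟩
  · rintro p (rfl | hp) q (rfl | hq) hle
    · simp [sp_self hw]
    · have h1 := g1 a haP q hq (hmax q hq)
      have h2 := sp_tri hG hw q a p
      have h3 := sp_tri hG hw x0 q p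
      linarith
    · have := hmax p hp; linarith
    · exact g1 p hp q hq hle
  · rintro p (rfl | hp) q (rfl | hq) hlt
    · exact absurd hlt (lt_irrefl _)
    · exact ⟨a, Or.inr haP, ha, e, hmax q hq⟩
    · have := hmax p hp; linarith
    · obtain ⟨c, hc, h⟩ := g2 p hp q hq hlt
      exact ⟨c, Or.inr hc, h⟩
  · rintro p (rfl | hp)
    · exact le_rfl
    · have := hmax p hp; linarith

/-- Restricting to a set closed under taking points on geodesics to the root. -/
lemma rest_facts (x0 : V) (P : Set V) (hP : Geo G w x0 P) (S : Set V) (hx : x0 ∈ S)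
    (hS : ∀ y z, z ∈ S → spDist G w x0 y + spDist G w y z = spDist G w x0 z → y ∈ S) :
    (G.induce S).Connected ∧
    (∀ z : S, spDist (G.induce S) (wres S w) ⟨x0, hx⟩ z = spDist G w x0 z) ∧
    Geo (G.induce S) (wres S w) ⟨x0, hx⟩ {p | p.1 ∈ P} := by
  have hwS := wres_pos S hw
  have hwalk : ∀ z : S, ∃ p : (G.induce S).Walk ⟨x0, hx⟩ z,
      plen (wres S w) p ≤ spDist G w x0 z := fun z =>
    interval_walk hG hw S ⟨x0, hx⟩ z.1 z.2 (fun y hy => hS y z z.2 hy)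
  have hC : (G.induce S).Connected := by
    rw [SimpleGraph.connected_iff_exists_forall_reachable]
    exact ⟨⟨x0, hx⟩, fun z => ⟨(hwalk z).choose⟩⟩
  have hd : ∀ z : S, spDist (G.induce S) (wres S w) ⟨x0, hx⟩ z = spDist G w x0 z := by
    intro z
    obtain ⟨p, hp⟩ := hwalk z
    exact le_antisymm ((sp_le_plen hwS p).trans hp) (sp_res_ge hG hw S hC ⟨x0, hx⟩ z)
  obtain ⟨g0, g1, g2⟩ := hP
  refine ⟨hC, hd, g0, ?_, ?_⟩
  · intro p hp q hq hle
    rw [hd, hd] at *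
    have h1 := g1 p hp q hq hle
    obtain ⟨W, hW⟩ := interval_walk hG hw S q p.1 p.2 (by
      intro y hy
      refine hS y p p.2 ?_
      have h2 := sp_tri hG hw x0 q y
      have h3 := sp_tri hG hw x0 y p
      linarith)
    have h4 := sp_res_ge hG hw S hC q p
    have h5 := (sp_le_plen hwS W).trans hW
    have : spDist (G.induce S) (wres S w) q p = spDist G w q p := le_antisymm h5 h4
    linarith
  · intro p hp q hq hlt
    rw [hd, hd] at hlt
    obtain ⟨a, ha, hadj, e, hle⟩ := g2 p hp q hq hlt
    have haS : a ∈ S := by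
      refine hS a p p.2 ?_
      have h2 := sp_tri hG hw x0 a p
      have h3 := sp_adj hw hadj
      linarith
    refine ⟨⟨a, haS⟩, ha, hadj, ?_, ?_⟩
    · rw [hd, hd]; exact e
    · rw [hd, hd]; exact hle

variable {x0 : V} {Q : Set V} (hQ : Geo G w x0 Q) {t : V} (htQ : t ∈ Q)
  (htmax : ∀ p ∈ Q, spDist G w x0 p ≤ spDist G w x0 t)

omit [Finite V] in
lemma petal_mono {r s : ℝ} (hrs : r ≤ s) : Petal G w x0 Q t r ⊆ Petal G w x0 Q t s := by
  rintro z ⟨p, hp, h1, h2⟩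
  exact ⟨p, hp, by linarith, by linarith⟩

omit [Finite V] in
lemma petal_pad {r η : ℝ} {z y : V} (hz : z ∈ Petal G w x0 Q t r) (hzy : spDist G w z y ≤ η) :
    y ∈ Petal G w x0 Q t (r + 4 * η) := by
  obtain ⟨p, hp, h1, h2⟩ := hz
  have h0 := sp_nonneg hw z y
  refine ⟨p, hp, by linarith, ?_⟩
  have h3 := sp_tri hG hw p z y
  have h4 := sp_tri hG hw x0 y z
  have h5 := sp_comm (G := G) (w := w) y z
  linarith

omit [Finite V] in
lemma petal_closed {r : ℝ} {y z : V} (hy : y ∈ Petal G w x0 Q t r)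
    (h : spDist G w x0 y + spDist G w y z = spDist G w x0 z) : z ∈ Petal G w x0 Q t r := by
  obtain ⟨p, hp, h1, h2⟩ := hy
  refine ⟨p, hp, h1, ?_⟩
  have h3 := sp_tri hG hw p y z
  linarith

include hQ htQ htmax

omit [Finite V] in
lemma mem_petal_of {r : ℝ} {p : V} (hp : p ∈ Q) (h : spDist G w p t ≤ r) :
    p ∈ Petal G w x0 Q t r :=
  ⟨p, hp, h, by rw [sp_self hw]; linarith⟩

omit [Finite V] in
lemma petal_far {r : ℝ} {z : V} (hz : z ∈ Petal G w x0 Q t r) :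
    spDist G w x0 t - 3 / 2 * r ≤ spDist G w x0 z := by
  obtain ⟨p, hp, h1, h2⟩ := hz
  have h3 := hQ.2.1 t htQ p hp (htmax p hp)
  have h4 := sp_nonneg hw p z
  have h5 := sp_nonneg hw p t
  linarith

omit [Finite V] in
lemma petal_inter {r : ℝ} {p : V} (hp : p ∈ Q) (hz : p ∈ Petal G w x0 Q t r) :
    spDist G w p t ≤ r := by
  obtain ⟨q, hq, h1, h2⟩ := hz
  by_contra! hlt
  have h3 := hQ.2.1 t htQ p hp (htmax p hp)
  have h4 := hQ.2.1 t htQ q hq (htmax q hq)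
  have h5 := hQ.2.1 q hq p hp (by linarith)
  have h6 := sp_comm (G := G) (w := w) p q
  linarith

lemma exists_base {r : ℝ} (hr : 0 ≤ r) (hrt : r < spDist G w x0 t) :
    ∃ b ∈ Q, spDist G w b t ≤ r ∧
      (∀ p ∈ Q, spDist G w p t ≤ r → spDist G w x0 b ≤ spDist G w x0 p) ∧
      ∃ a ∈ Q, G.Adj a b ∧ spDist G w x0 b = spDist G w x0 a + w s(a, b) ∧
        r < spDist G w a t := by
  obtain ⟨b, ⟨hb, hbr⟩, hmin⟩ := (Set.toFinite {p | p ∈ Q ∧ spDist G w p t ≤ r}).exists_minimalFor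
    (fun p => spDist G w x0 p) _ ⟨t, htQ, by rw [sp_self hw]; exact hr⟩
  have hmin' : ∀ p ∈ Q, spDist G w p t ≤ r → spDist G w x0 b ≤ spDist G w x0 p := by
    intro p hp hpr
    by_contra! hlt
    have := hmin ⟨hp, hpr⟩ hlt.le
    simp only at this
    linarith
  refine ⟨b, hb, hbr, hmin', ?_⟩
  have h3 := hQ.2.1 t htQ b hb (htmax b hb)
  obtain ⟨a, ha, hadj, e, -⟩ := hQ.2.2 b hb x0 hQ.1 (by rw [sp_self hw]; linarith)
  refine ⟨a, ha, hadj, e, ?_⟩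
  by_contra! hle
  have := hmin' a ha hle
  have := hw s(a, b) hadj
  linarith

lemma petal_facts {r : ℝ} {b : V} (hbQ : b ∈ Q) (hbr : spDist G w b t ≤ r)
    (hbmin : ∀ p ∈ Q, spDist G w p t ≤ r → spDist G w x0 b ≤ spDist G w x0 p)
    (w' : Sym2 V → ℝ) (θ : ℝ) (hθ : 0 < θ)
    (hw1 : ∀ e ∈ G.edgeSet, θ * w e ≤ w' e) (hw2 : ∀ e ∈ G.edgeSet, w' e ≤ w e)
    (hw3 : ∀ a ∈ Q, ∀ c ∈ Q, w' s(a, c) = θ * w s(a, c))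
    (hb : b ∈ Petal G w x0 Q t r) :
    (G.induce (Petal G w x0 Q t r)).Connected ∧
    Geo (G.induce (Petal G w x0 Q t r)) (wres (Petal G w x0 Q t r) w') ⟨b, hb⟩ {p | p.1 ∈ Q} ∧
    (∀ p : Petal G w x0 Q t r, p.1 ∈ Q →
      spDist (G.induce (Petal G w x0 Q t r)) (wres (Petal G w x0 Q t r) w') ⟨b, hb⟩ p =
        θ * (spDist G w x0 p - spDist G w x0 b)) ∧
    (∀ z : Petal G w x0 Q t r, ∃ p ∈ Q, spDist G w p t ≤ r ∧
      spDist (G.induce (Petal G w x0 Q t r)) (wres (Petal G w x0 Q t r) w') ⟨b, hb⟩ z ≤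
        θ * (spDist G w x0 p - spDist G w x0 b) + spDist G w x0 z - spDist G w x0 p +
          (r - spDist G w p t) / 2) := by
  set S := Petal G w x0 Q t r with hSdef
  have hw' : ∀ e ∈ G.edgeSet, 0 < w' e := fun e he =>
    lt_of_lt_of_le (mul_pos hθ (hw e he)) (hw1 e he)
  have hwS := wres_pos S hw'
  have inter : ∀ p ∈ Q, p ∈ S → spDist G w p t ≤ r := fun p hp hpS =>
    petal_inter hG hw hQ htQ htmax hp hpS
  have W1 : ∀ q : S, q.1 ∈ Q → ∀ p, ∀ hp : p ∈ S, p ∈ Q → spDist G w x0 q ≤ spDist G w x0 p →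
      ∃ W : (G.induce S).Walk q ⟨p, hp⟩, plen (wres S w') W ≤
        θ * (spDist G w x0 p - spDist G w x0 q) := by
    intro q hq p
    refine real_induction (fun p => spDist G w x0 p) (fun p => ∀ hp : p ∈ S, p ∈ Q →
      spDist G w x0 q ≤ spDist G w x0 p →
      ∃ W : (G.induce S).Walk q ⟨p, hp⟩, plen (wres S w') W ≤
        θ * (spDist G w x0 p - spDist G w x0 q)) ?_ p
    intro p ih hp hpQ hle
    by_cases hqp : q.1 = p
    · subst hqp
      exact ⟨SimpleGraph.Walk.nil, by simp [plen]⟩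
    have hlt : spDist G w x0 q < spDist G w x0 p := by
      have := hQ.2.1 p hpQ q hq hle
      linarith [sp_pos hG hw hqp]
    obtain ⟨a, ha, hadj, e, hqa⟩ := hQ.2.2 p hpQ q hq hlt
    have haS : a ∈ S := by
      refine mem_petal_of hG hw hQ htQ htmax ha ?_
      have h1 := hQ.2.1 t htQ q hq (htmax q hq)
      have h2 := hQ.2.1 t htQ a ha (htmax a ha)
      have h3 := inter q hq q.2
      linarith
    have := hw s(a, p) hadj
    obtain ⟨W, hW⟩ := ih a (by linarith) haS ha hqa
    have hav : (G.induce S).Adj ⟨a, haS⟩ ⟨p, hp⟩ := hadj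
    refine ⟨W.append hav.toWalk, ?_⟩
    rw [plen_append, e]
    have : plen (wres S w') hav.toWalk = θ * w s(a, p) := by
      rw [← hw3 a ha p hpQ]; simp [plen, wres]
    linarith
  have W2 : ∀ z : S, ∃ p ∈ Q, spDist G w p t ≤ r ∧ ∃ W : (G.induce S).Walk ⟨b, hb⟩ z,
      plen (wres S w') W ≤ θ * (spDist G w x0 p - spDist G w x0 b) + spDist G w x0 z
        - spDist G w x0 p + (r - spDist G w p t) / 2 := by
    rintro ⟨z, hz⟩
    obtain ⟨p, hp, hpr, hc⟩ := hz
    have hpS : p ∈ S := mem_petal_of hG hw hQ htQ htmax hp hpr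
    obtain ⟨A, hA⟩ := W1 ⟨b, hb⟩ hbQ p hpS hp (hbmin p hp hpr)
    obtain ⟨B, hB⟩ := interval_walk hG hw S ⟨p, hpS⟩ z ⟨p, hp, hpr, hc⟩ (by
      intro y hy
      refine ⟨p, hp, hpr, ?_⟩
      have h1 := sp_tri hG hw x0 y z
      simp only at hy
      linarith)
    refine ⟨p, hp, hpr, A.append B, ?_⟩
    rw [plen_append]
    have hBm : plen (wres S w') B ≤ plen (wres S w) B := by
      apply plen_mono
      intro e
      induction e with
      | h a c => intro h; exact hw2 s(a.1, c.1) h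
    simp only at hA hB ⊢
    linarith
  have hC : (G.induce S).Connected := by
    rw [SimpleGraph.connected_iff_exists_forall_reachable]
    refine ⟨⟨b, hb⟩, fun z => ?_⟩
    obtain ⟨p, hp, hpr, W, -⟩ := W2 z
    exact ⟨W⟩
  have lower : ∀ u v : S, θ * spDist G w u v ≤ spDist (G.induce S) (wres S w') u v := by
    intro u v
    have := sp_lip (w := wres S w') hC (fun v => θ * spDist G w u v) (by
      intro a c hac
      have hac' : G.Adj a.1 c.1 := hac
      have h1 := sp_adj hw hac'
      have h2 := sp_tri hG hw u a c
      have h3 := hw1 s(a.1, c.1) hac'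
      simp only [wres, Sym2.map_mk]
      nlinarith) u v
    simp only [sp_self hw] at this
    linarith
  have exact1 : ∀ q p : S, q.1 ∈ Q → p.1 ∈ Q → spDist G w x0 q ≤ spDist G w x0 p →
      spDist (G.induce S) (wres S w') q p = θ * (spDist G w x0 p - spDist G w x0 q) := by
    intro q p hq hp hle
    obtain ⟨A, hA⟩ := W1 q hq p p.2 hp hle
    refine le_antisymm ((sp_le_plen hwS A).trans hA) ?_
    have h1 := hQ.2.1 p hp q hq hle
    have h2 := lower q p
    have : spDist G w x0 p - spDist G w x0 q = spDist G w q p := by linarith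
    rw [this]; exact h2
  have hbd : ∀ p : S, p.1 ∈ Q → spDist (G.induce S) (wres S w') ⟨b, hb⟩ p =
        θ * (spDist G w x0 p - spDist G w x0 b) := fun p hp =>
    exact1 ⟨b, hb⟩ p hbQ hp (hbmin p hp (inter p hp p.2))
  refine ⟨hC, ⟨hbQ, ?_, ?_⟩, hbd, ?_⟩
  · intro p hp q hq hle
    rw [hbd p hp, hbd q hq] at hle
    have hle' : spDist G w x0 q ≤ spDist G w x0 p := by
      have := le_of_mul_le_mul_left hle hθ
      linarith
    rw [hbd p hp, hbd q hq, exact1 q p hq hp hle']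
    ring
  · intro p hp q hq hlt
    rw [hbd p hp, hbd q hq] at hlt
    have hlt' : spDist G w x0 q < spDist G w x0 p := by
      have := lt_of_mul_lt_mul_left hlt hθ.le
      linarith
    obtain ⟨a, ha, hadj, e, hqa⟩ := hQ.2.2 p hp q hq hlt'
    have haS : a ∈ S := by
      refine mem_petal_of hG hw hQ htQ htmax ha ?_
      have h1 := hQ.2.1 t htQ q hq (htmax q hq)
      have h2 := hQ.2.1 t htQ a ha (htmax a ha)
      have h3 := inter q hq q.2
      linarith
    refine ⟨⟨a, haS⟩, ha, hadj, ?_, ?_⟩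
    · rw [hbd p hp, hbd ⟨a, haS⟩ ha]
      have : wres S w' s(⟨a, haS⟩, p) = θ * w s(a, p.1) := by
        rw [← hw3 a ha p hp]; simp [wres]
      rw [this, e]; ring
    · rw [hbd q hq, hbd ⟨a, haS⟩ ha]
      exact mul_le_mul_of_nonneg_left (by simpa using hqa) hθ.le
  · intro z
    obtain ⟨p, hp, hpr, W, hW⟩ := W2 z
    exact ⟨p, hp, hpr, (sp_le_plen hwS W).trans hW⟩

end Petals

/-! ### The recursion -/

/-- Invariant of a cluster: `w` is the current weight, `w0` the original one; only edges inside
the geodesic set `P` may have been shrunk (by a factor at most `2`). -/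
structure State {V : Type} (G : SimpleGraph V) (w0 w : Sym2 V → ℝ) (x0 : V) (P : Set V) :
    Prop where
  conn : G.Connected
  pos : ∀ e ∈ G.edgeSet, 0 < w e
  le : ∀ e ∈ G.edgeSet, w e ≤ w0 e
  ge : ∀ e ∈ G.edgeSet, w0 e ≤ 2 * w e
  eq : ∀ a b, G.Adj a b → ¬ (a ∈ P ∧ b ∈ P) → w s(a, b) = w0 s(a, b)
  geo : Geo G w x0 P

lemma State.pos0 {V : Type} {G : SimpleGraph V} {w0 w : Sym2 V → ℝ} {x0 : V} {P : Set V}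
    (h : State G w0 w x0 P) : ∀ e ∈ G.edgeSet, 0 < w0 e := fun e he =>
  lt_of_lt_of_le (h.pos e he) (h.le e he)

/-- Existence of a good clan for a cluster. -/
def Good {V : Type} [Fintype V] (G : SimpleGraph V) (w0 w : Sym2 V → ℝ) (x0 : V) (P : Set V)
    (μ : V → ℝ) (κ : ℝ) (L : ℕ) : Prop :=
  ∃ c : Clan G, c.pr c.root = x0 ∧
    (∀ y, c.D w0 c.root y ≤ 4 * spDist G w x0 (c.pr y)) ∧
    (∀ p ∈ P, ∃ y, c.pr y = p ∧ c.D w0 c.root y ≤ 2 * spDist G w x0 p) ∧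
    (∑ y, μ (c.pr y) ≤ (∑ v, μ v) ^ (1 + κ)) ∧
    (∀ u v, ∃ y, c.pr y = v ∧ c.D w0 y (c.chief u) ≤ 512 * L * spDist G w u v)

lemma good_base {V : Type} [Fintype V] (G : SimpleGraph V) (w0 w : Sym2 V → ℝ) (x0 : V) (P : Set V)
    (μ : V → ℝ) (κ : ℝ) (hκ : 0 < κ) (L : ℕ) (hs : State G w0 w x0 P) (hμ : ∀ v, 1 ≤ μ v)
    (hV : ∀ v, v = x0) : Good G w0 w x0 P μ κ L := by
  let c : Clan G :=
    { Y := Unit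
      fin := inferInstance
      T := ⊥
      tree := SimpleGraph.IsTree.of_subsingleton
      pr := fun _ => x0
      hom := by intro a b h; exact absurd h (by simp)
      root := ()
      chief := fun _ => ()
      pr_chief := fun v => (hV v).symm }
  have hD : ∀ a b : c.Y, c.D w0 a b = 0 := by
    intro a b
    exact sp_self (c.wpos hs.pos0) _
  have hn := fun u v => sp_nonneg hs.pos u v
  refine ⟨c, rfl, ?_, ?_, ?_, ?_⟩
  · intro y
    rw [hD]; have := hn x0 (c.pr y); positivity
  · intro p _
    refine ⟨(), (hV p).symm, ?_⟩
    rw [hD]; have := hn x0 p; positivity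
  · have h1 : ∑ y : c.Y, μ (c.pr y) = μ x0 := by
      change ∑ y : Unit, μ x0 = μ x0
      simp
    have h2 : ∑ v, μ v = μ x0 := by
      have : (Finset.univ : Finset V) = {x0} := by ext v; simp [hV v]
      rw [this]; simp
    rw [h1, h2]
    calc μ x0 = μ x0 ^ (1:ℝ) := (Real.rpow_one _).symm
      _ ≤ _ := Real.rpow_le_rpow_of_exponent_le (hμ x0) (by linarith)
  · intro u v
    refine ⟨(), (hV v).symm, ?_⟩
    rw [hD]; have := hn u v; positivity

/-- The choice of the direction of the petal. -/
lemma choose_dir {V : Type} [Finite V] {G : SimpleGraph V} {w0 w : Sym2 V → ℝ} {x0 : V} {P : Set V}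
    (hs : State G w0 w x0 P) (Δ : ℝ) (hΔ : 0 < Δ) (x1 : V) (hx1 : spDist G w x0 x1 = Δ)
    (hmax : ∀ v, spDist G w x0 v ≤ Δ) :
    ∃ (Q : Set V) (t : V) (θ : ℝ) (w' : Sym2 V → ℝ), Geo G w x0 Q ∧ t ∈ Q ∧
      (∀ p ∈ Q, spDist G w x0 p ≤ spDist G w x0 t) ∧ Δ / 2 ≤ spDist G w x0 t ∧
      0 < θ ∧ (∀ e ∈ G.edgeSet, θ * w e ≤ w' e) ∧ (∀ e ∈ G.edgeSet, w' e ≤ w e) ∧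
      (∀ a ∈ Q, ∀ c ∈ Q, w' s(a, c) = θ * w s(a, c)) ∧
      (∀ r, r ≤ Δ / 4 → ∀ a ∈ Petal G w x0 Q t r, ∀ c ∈ Petal G w x0 Q t r, G.Adj a c →
        w0 s(a, c) ≤ 2 * w' s(a, c) ∧ (¬ (a ∈ Q ∧ c ∈ Q) → w' s(a, c) = w0 s(a, c))) ∧
      ((θ = 1 ∧ Q = P) ∨ (θ = 1 / 2 ∧
        ∀ r, r ≤ Δ / 4 → ∀ z ∈ Petal G w x0 Q t r, z ∉ P)) := by
  classical
  obtain ⟨t, htP, htmax⟩ := (Set.toFinite P).exists_maximalFor (fun p => spDist G w x0 p) _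
    ⟨x0, hs.geo.1⟩
  have htmax' : ∀ p ∈ P, spDist G w x0 p ≤ spDist G w x0 t := by
    intro p hp
    by_contra! hlt
    have := htmax hp hlt.le
    simp only at this
    linarith
  by_cases hcase : Δ / 2 ≤ spDist G w x0 t
  · refine ⟨P, t, 1, w, hs.geo, htP, htmax', hcase, one_pos, fun e _ => by linarith,
      fun e _ => le_rfl, fun a _ c _ => by ring, ?_, Or.inl ⟨rfl, rfl⟩⟩
    intro r hr a _ c _ hadj
    exact ⟨hs.ge s(a, c) hadj, fun h => hs.eq a c hadj h⟩
  · push Not at hcase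
    obtain ⟨Q, hQ, h1Q, hQmax⟩ := exists_geo hs.conn hs.pos x0 x1
    have hnP : ∀ r, r ≤ Δ / 4 → ∀ z ∈ Petal G w x0 Q x1 r, z ∉ P := by
      intro r hr z hz hzP
      have h1 := petal_far hs.conn hs.pos hQ h1Q hQmax hz
      have h2 := htmax' z hzP
      linarith
    refine ⟨Q, x1, 1 / 2, fun e => if ∀ v ∈ e, v ∈ Q then 1 / 2 * w e else w e, hQ, h1Q, hQmax,
      by linarith, by norm_num, ?_, ?_, ?_, ?_, Or.inr ⟨rfl, hnP⟩⟩
    · intro e he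
      have := hs.pos e he
      dsimp only
      split_ifs <;> linarith
    · intro e he
      have := hs.pos e he
      dsimp only
      split_ifs <;> linarith
    · intro a ha c hc
      simp [ha, hc]
    · intro r hr a ha c hc hadj
      have h1 := hs.eq a c hadj (fun h => hnP r hr a ha h.1)
      have h2 := hs.pos s(a, c) hadj
      constructor
      · dsimp only
        split_ifs <;> linarith
      · intro h
        have : ¬ ∀ v ∈ s(a, c), v ∈ Q := by simpa using h
        dsimp only
        rw [if_neg this, h1]

lemma main_rec (κ : ℝ) (hκ : 0 < κ) (L : ℕ) (hL : 1 ≤ L) (M : ℝ)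
    (hM : Real.logb 2 M ≤ (1 + κ) ^ L) (n : ℕ) :
    ∀ (V : Type) [Fintype V] (G : SimpleGraph V) (w0 w : Sym2 V → ℝ) (x0 : V) (P : Set V)
      (μ : V → ℝ), Fintype.card V = n → State G w0 w x0 P → (∀ v, 1 ≤ μ v) → ∑ v, μ v ≤ M →
      Good G w0 w x0 P μ κ L := by
  classical
  induction n using Nat.strong_induction_on with
  | _ n ih =>
  intro V _ G w0 w x0 P μ hn hs hμ hμM
  by_cases hV : ∀ v, v = x0
  · exact good_base G w0 w x0 P μ κ hκ L hs hμ hV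
  push Not at hV
  obtain ⟨v1, hv1⟩ := hV
  have hG := hs.conn
  have hw := hs.pos
  have hw0 := hs.pos0
  have hLr : (1:ℝ) ≤ L := by exact_mod_cast hL
  -- the radius
  obtain ⟨x1, -, hx1⟩ := Finset.exists_max_image Finset.univ (fun v => spDist G w x0 v)
    ⟨x0, Finset.mem_univ _⟩
  obtain ⟨Δ, hΔdef⟩ : ∃ Δ, spDist G w x0 x1 = Δ := ⟨_, rfl⟩
  have hmax : ∀ v, spDist G w x0 v ≤ Δ := fun v => hΔdef ▸ hx1 v (Finset.mem_univ _)
  have hΔ : 0 < Δ := lt_of_lt_of_le (sp_pos hG hw hv1.symm) (hmax v1)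
  obtain ⟨Q, t, θ, w', hQ, htQ, htmax, htΔ, hθ, hw1, hw2, hw3, hw4, hAB⟩ :=
    choose_dir hs Δ hΔ x1 hΔdef hmax
  -- the cut
  obtain ⟨δ, hδdef⟩ : ∃ δ, δ = Δ / (8 * L) := ⟨_, rfl⟩
  have hδ : 0 < δ := by rw [hδdef]; positivity
  have hδL : δ * (8 * L) = Δ := by rw [hδdef]; field_simp
  let W : ℝ → Set V := fun r => Petal G w x0 Q t r
  have hx0W : ∀ r, 0 ≤ r → r ≤ Δ / 4 → x0 ∉ W r := by
    intro r h0 hr hx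
    have := petal_far hG hw hQ htQ htmax hx
    rw [sp_self hw] at this
    linarith
  have htW : ∀ r, 0 ≤ r → t ∈ W r := fun r hr =>
    mem_petal_of hG hw hQ htQ htmax htQ (by rw [sp_self hw]; exact hr)
  have hrange : ∀ i : ℕ, i ≤ 2 * L → (i:ℝ) * δ ≤ Δ / 4 := by
    intro i hi
    have : (i:ℝ) ≤ 2 * L := by exact_mod_cast hi
    nlinarith
  have hsplit : ∀ S : Set V, ∑ v : S, μ v + ∑ v : (Sᶜ : Set V), μ v = ∑ v, μ v := by
    intro S
    exact Fintype.sum_subtype_add_sum_subtype (fun v => v ∈ S) μ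
  have hone : ∀ (S : Set V) (x : V), x ∈ S → 1 ≤ ∑ v : S, μ v := by
    intro S x hx
    refine (hμ x).trans ?_
    exact Finset.single_le_sum (f := fun v : S => μ v)
      (fun v _ => by linarith [hμ v.1]) (Finset.mem_univ (⟨x, hx⟩ : S))
  have honec : ∀ (S : Set V) (x : V), x ∈ Sᶜ → 1 ≤ ∑ v : (Sᶜ : Set V), μ v := by
    intro S x hx
    refine (hμ x).trans ?_
    exact Finset.single_le_sum (f := fun v : (Sᶜ : Set V) => μ v)
      (fun v _ => by linarith [hμ v.1]) (Finset.mem_univ (⟨x, hx⟩ : (Sᶜ : Set V)))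
  obtain ⟨i, hi, hcut⟩ := choose_cut κ hκ L hL M (∑ v, μ v) hμM hM
    (fun i => ∑ v : W (i * δ), μ v)
    (fun i hi => hone _ t (htW _ (by positivity)))
    (fun i hi => by
      have h1 := hsplit (W (i * δ))
      have h2 := honec (W (i * δ)) x0 (hx0W _ (by positivity) (hrange i hi))
      linarith)
  obtain ⟨r0, hr0⟩ : ∃ r0, r0 = (i:ℝ) * δ := ⟨_, rfl⟩
  obtain ⟨r1, hr1⟩ : ∃ r1, r1 = ((i + 1 : ℕ):ℝ) * δ := ⟨_, rfl⟩
  have hr01 : r1 = r0 + δ := by rw [hr0, hr1]; push_cast; ring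
  have hr0n : 0 ≤ r0 := by rw [hr0]; positivity
  have hr1n : 0 ≤ r1 := by linarith
  have hr1Δ : r1 ≤ Δ / 4 := by rw [hr1]; exact hrange (i+1) hi
  have hr0Δ : r0 ≤ Δ / 4 := by linarith
  rw [← hr0, ← hr1] at hcut
  -- the two clusters
  obtain ⟨b, hbQ, hbr, hbmin, a, haQ, hab, hbe, har⟩ :=
    exists_base hG hw hQ htQ htmax hr1n (show r1 < spDist G w x0 t by linarith)
  have hbW : b ∈ W r1 := mem_petal_of hG hw hQ htQ htmax hbQ hbr
  obtain ⟨hC1, hGeo1, hd1, hroot1⟩ := petal_facts hG hw hQ htQ htmax hbQ hbr hbmin w' θ hθ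
    hw1 hw2 hw3 hbW
  have hx0S : x0 ∈ (W r0)ᶜ := hx0W r0 hr0n hr0Δ
  obtain ⟨hC0, hd0, hGeo0⟩ := rest_facts hG hw x0 P hs.geo (W r0)ᶜ hx0S (by
    intro y z hz h hy
    exact hz (petal_closed hG hw hy h))
  have hw'pos : ∀ e ∈ G.edgeSet, 0 < w' e := fun e he =>
    lt_of_lt_of_le (mul_pos hθ (hw e he)) (hw1 e he)
  have st0 : State (G.induce (W r0)ᶜ) (wres _ w0) (wres _ w) ⟨x0, hx0S⟩ {p | p.1 ∈ P} :=
    { conn := hC0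
      pos := wres_pos _ hw
      le := by
        intro e
        induction e with
        | h a c => intro h; exact hs.le s(a.1, c.1) h
      ge := by
        intro e
        induction e with
        | h a c => intro h; exact hs.ge s(a.1, c.1) h
      eq := fun a c h hn => hs.eq a.1 c.1 h hn
      geo := hGeo0 }
  have st1 : State (G.induce (W r1)) (wres _ w0) (wres _ w') ⟨b, hbW⟩ {p | p.1 ∈ Q} :=
    { conn := hC1
      pos := wres_pos _ hw'pos
      le := by
        intro e
        induction e with
        | h a c => intro h; exact (hw2 s(a.1, c.1) h).trans (hs.le s(a.1, c.1) h)
      ge := by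
        intro e
        induction e with
        | h a c => intro h; exact (hw4 r1 hr1Δ a.1 a.2 c.1 c.2 h).1
      eq := fun a c h hn => (hw4 r1 hr1Δ a.1 a.2 c.1 c.2 h).2 hn
      geo := hGeo1 }
  have hm0 := hsplit (W r0)
  have hm1 := hsplit (W r1)
  have hn0 : 0 ≤ ∑ v : W r0, μ v := Finset.sum_nonneg (fun v _ => by linarith [hμ v.1])
  have hn1 : 0 ≤ ∑ v : ((W r1)ᶜ : Set V), μ v :=
    Finset.sum_nonneg (fun v _ => by linarith [hμ v.1])
  obtain ⟨c₀, hroot0, hA0, hP0, hsum0, hpair0⟩ := ih (Fintype.card ((W r0)ᶜ : Set V))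
    (by rw [← hn]; exact Fintype.card_subtype_lt (x := t) (fun h => h (htW r0 hr0n)))
    ((W r0)ᶜ : Set V) (G.induce (W r0)ᶜ) (wres _ w0) (wres _ w) ⟨x0, hx0S⟩ {p | p.1 ∈ P}
    (fun v => μ v) rfl st0 (fun v => hμ v) (by linarith)
  obtain ⟨c₁, hrootb, hA1, hP1, hsum1, hpair1⟩ := ih (Fintype.card (W r1))
    (by rw [← hn]; exact Fintype.card_subtype_lt (x := x0) (hx0W r1 hr1n hr1Δ))
    (W r1) (G.induce (W r1)) (wres _ w0) (wres _ w') ⟨b, hbW⟩ {p | p.1 ∈ Q}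
    (fun v => μ v) rfl st1 (fun v => hμ v) (by linarith)
  have haS : a ∈ (W r0)ᶜ := by
    intro h
    have := petal_inter hG hw hQ htQ htmax haQ h
    linarith
  obtain ⟨γ, ya, hya, hγ, hAB'⟩ : ∃ (γ : ℝ) (ya : c₀.Y), c₀.pr ya = ⟨a, haS⟩ ∧
      c₀.D (wres _ w0) c₀.root ya ≤ γ * spDist G w x0 a ∧
      ((γ = 2 ∧ θ = 1 ∧ Q = P) ∨ (γ = 4 ∧ θ = 1 / 2 ∧
        ∀ r, r ≤ Δ / 4 → ∀ z ∈ Petal G w x0 Q t r, z ∉ P)) := by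
    rcases hAB with ⟨h1, h2⟩ | ⟨h1, h2⟩
    · obtain ⟨y, hy, hyd⟩ := hP0 ⟨a, haS⟩ (show a ∈ P from h2 ▸ haQ)
      rw [hd0] at hyd
      exact ⟨2, y, hy, hyd, Or.inl ⟨rfl, h1, h2⟩⟩
    · refine ⟨4, c₀.chief ⟨a, haS⟩, c₀.pr_chief _, ?_, Or.inr ⟨rfl, h1, h2⟩⟩
      have := hA0 (c₀.chief ⟨a, haS⟩)
      rw [hd0, c₀.pr_chief] at this
      exact this
  have hadj : G.Adj (c₀.pr ya).1 (c₁.pr c₁.root).1 := by rw [hya, hrootb]; exact hab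
  let Mid : Set V := W (r0 + δ / 2)
  have hMid1 : ∀ v, v ∈ Mid → v ∈ W r1 := fun v hv =>
    petal_mono hG hw (by linarith) hv
  have hMid0 : ∀ v, v ∉ Mid → v ∈ (W r0)ᶜ := fun v hv h =>
    hv (petal_mono hG hw (by linarith) h)
  let c := Clan.glue c₀ c₁ ya hadj Mid hMid1 hMid0
  have hwab := hw s(a, b) hab
  have hw0ab := hs.ge s(a, b) hab
  have hrootR : ∀ y : c₁.Y, c.D w0 c.root (Sum.inr y) ≤ γ * spDist G w x0 a + w0 s(a, b) +
      c₁.D (wres _ w0) c₁.root y := by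
    intro y
    have h := Clan.glue_root_inr hw0 c₀ c₁ ya hadj Mid hMid1 hMid0 y
    rw [hya, hrootb] at h
    have h' : c.D w0 c.root (Sum.inr y) ≤ c₀.D (wres _ w0) c₀.root ya + w0 s(a, b) +
      c₁.D (wres _ w0) c₁.root y := h
    linarith
  have hbt := hQ.2.1 t htQ b hbQ (htmax b hbQ)
  have hat := hQ.2.1 t htQ a haQ (htmax a haQ)
  have hheight : ∀ y : c.Y, c.D w0 c.root y ≤ 4 * spDist G w x0 (c.pr y) := by
    rintro (y | y)
    · have h1 : c.D w0 c.root (Sum.inl y) ≤ c₀.D (wres _ w0) c₀.root y :=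
        Clan.glue_inl hw0 c₀ c₁ ya hadj Mid hMid1 hMid0 c₀.root y
      have h2 := hA0 y
      rw [hd0] at h2
      exact h1.trans h2
    · have h1 := hrootR y
      have h2 := hA1 y
      obtain ⟨p, hp, hpr, h3⟩ := hroot1 (c₁.pr y)
      have h4 := hQ.2.1 t htQ p hp (htmax p hp)
      have h5 := hbmin p hp hpr
      have h6 := sp_nonneg hw p t
      change _ ≤ 4 * spDist G w x0 (c₁.pr y).1
      rcases hAB' with ⟨rfl, rfl, -⟩ | ⟨rfl, rfl, -⟩
      · linarith
      · linarith
  refine ⟨c, ?_, hheight, ?_, ?_, ?_⟩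
  · change (c₀.pr c₀.root).1 = x0
    rw [hroot0]
  · intro p hp
    by_cases hpW : p ∈ W r0
    · rcases hAB' with ⟨rfl, rfl, hQP⟩ | ⟨-, -, hno⟩
      · have hpW1 : p ∈ W r1 := petal_mono hG hw (by linarith) hpW
        have hpQ : p ∈ Q := hQP ▸ hp
        obtain ⟨y, hy, hyd⟩ := hP1 ⟨p, hpW1⟩ hpQ
        refine ⟨Sum.inr y, ?_, ?_⟩
        · change (c₁.pr y).1 = p
          rw [hy]
        · have h1 := hrootR y
          rw [hd1 ⟨p, hpW1⟩ hpQ] at hyd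
          simp only at hyd
          linarith
      · exact absurd hp (hno r0 hr0Δ p hpW)
    · obtain ⟨y, hy, hyd⟩ := hP0 ⟨p, hpW⟩ hp
      rw [hd0] at hyd
      refine ⟨Sum.inl y, ?_, ?_⟩
      · change (c₀.pr y).1 = p
        rw [hy]
      · exact (Clan.glue_inl hw0 c₀ c₁ ya hadj Mid hMid1 hMid0 c₀.root y).trans hyd
  · have h1 : ∑ y : c.Y, μ (c.pr y) = ∑ y, μ (c₀.pr y).1 + ∑ y, μ (c₁.pr y).1 :=
      Fintype.sum_sum_type (fun y : c₀.Y ⊕ c₁.Y => μ (c.pr y))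
    rw [h1]
    have h2 : ∑ v, μ v - ∑ v : W r0, μ v = ∑ v : ((W r0)ᶜ : Set V), μ v := by linarith
    rw [h2] at hcut
    linarith
  · intro u v
    by_cases hpad : spDist G w u v ≤ δ / 8
    · by_cases hu : u ∈ Mid
      · have hin : ∀ y, spDist G w u y ≤ δ / 8 → y ∈ W r1 := by
          intro y hy
          have := petal_pad hG hw hu hy
          have e : r0 + δ / 2 + 4 * (δ / 8) = r1 := by rw [hr01]; ring
          rw [e] at this
          exact this
        have hvW := hin v hpad
        obtain ⟨y, hy, hyd⟩ := hpair1 ⟨u, hMid1 u hu⟩ ⟨v, hvW⟩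
        obtain ⟨A, hA⟩ := interval_walk hG hw (W r1) ⟨u, hMid1 u hu⟩ v hvW (by
          intro z hz
          apply hin
          have := sp_nonneg hw z v
          simp only at hz
          linarith)
        have hAm : plen (wres (W r1) w') A ≤ plen (wres (W r1) w) A := by
          apply plen_mono
          intro e
          induction e with
          | h a c => intro h; exact hw2 s(a.1, c.1) h
        have hle := (sp_le_plen (wres_pos _ hw'pos) A).trans (hAm.trans hA)
        refine ⟨Sum.inr y, ?_, ?_⟩
        · change (c₁.pr y).1 = v
          rw [hy]
        · have hch : c.chief u = Sum.inr (c₁.chief ⟨u, hMid1 u hu⟩) := dif_pos hu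
          rw [hch]
          refine ((Clan.glue_inr hw0 c₀ c₁ ya hadj Mid hMid1 hMid0 y _).trans hyd).trans ?_
          exact mul_le_mul_of_nonneg_left hle (by positivity)
      · have hin : ∀ y, spDist G w u y ≤ δ / 8 → y ∈ (W r0)ᶜ := by
          intro y hy hyW
          rw [sp_comm] at hy
          have := petal_pad hG hw hyW hy
          have e : r0 + 4 * (δ / 8) = r0 + δ / 2 := by ring
          rw [e] at this
          exact hu this
        have hvW := hin v hpad
        obtain ⟨y, hy, hyd⟩ := hpair0 ⟨u, hMid0 u hu⟩ ⟨v, hvW⟩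
        obtain ⟨A, hA⟩ := interval_walk hG hw (W r0)ᶜ ⟨u, hMid0 u hu⟩ v hvW (by
          intro z hz
          apply hin
          have := sp_nonneg hw z v
          simp only at hz
          linarith)
        have hle := (sp_le_plen (wres_pos _ hw) A).trans hA
        refine ⟨Sum.inl y, ?_, ?_⟩
        · change (c₀.pr y).1 = v
          rw [hy]
        · have hch : c.chief u = Sum.inl (c₀.chief ⟨u, hMid0 u hu⟩) := dif_neg hu
          rw [hch]
          refine ((Clan.glue_inl hw0 c₀ c₁ ya hadj Mid hMid1 hMid0 y _).trans hyd).trans ?_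
          exact mul_le_mul_of_nonneg_left hle (by positivity)
    · push Not at hpad
      refine ⟨c.chief v, c.pr_chief v, ?_⟩
      have h1 := c.D_tri hw0 (c.chief v) c.root (c.chief u)
      rw [c.D_comm (c.chief v) c.root] at h1
      have h2 := hheight (c.chief v)
      have h3 := hheight (c.chief u)
      have h4 := hmax (c.pr (c.chief v))
      have h5 := hmax (c.pr (c.chief u))
      have h6 : 8 * Δ ≤ 512 * L * spDist G w u v := by
        rw [← hδL]
        nlinarith
      linarith

lemma dist_const (k : ℕ) (hk : 1 ≤ k) (M : ℝ) (hM : 2 ≤ M) :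
    ∃ L : ℕ, 1 ≤ L ∧ Real.logb 2 M ≤ (1 + 1 / (k:ℝ)) ^ L ∧
      512 * (L:ℝ) ≤ 1024 * k * (1 + Real.logb 2 (Real.logb 2 M)) := by
  have hk' : (0:ℝ) < k := by exact_mod_cast hk
  have hl : 1 ≤ Real.logb 2 M := by
    rw [Real.le_logb_iff_rpow_le (by norm_num) (by linarith)]; simpa using hM
  have hll : 0 ≤ Real.logb 2 (Real.logb 2 M) := Real.logb_nonneg (by norm_num) hl
  set x := Real.logb 2 (Real.logb 2 M) with hx
  refine ⟨k * (⌈x⌉₊ + 1), by nlinarith [Nat.zero_le ⌈x⌉₊], ?_, ?_⟩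
  · rw [pow_mul]
    have h2 : (2:ℝ) ≤ (1 + 1 / (k:ℝ)) ^ k := by
      have := one_add_mul_le_pow (a := 1 / (k:ℝ)) (by have := (one_div_pos.mpr hk'); linarith) k
      have e : (k:ℝ) * (1 / (k:ℝ)) = 1 := by field_simp
      linarith
    calc Real.logb 2 M = (2:ℝ) ^ x := by
          rw [hx, Real.rpow_logb (by norm_num) (by norm_num) (by linarith)]
      _ ≤ (2:ℝ) ^ ((⌈x⌉₊ + 1 : ℕ) : ℝ) := by
          apply Real.rpow_le_rpow_of_exponent_le (by norm_num)
          have := Nat.le_ceil x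
          push_cast; linarith
      _ = (2:ℝ) ^ (⌈x⌉₊ + 1) := Real.rpow_natCast _ _
      _ ≤ _ := by gcongr
  · have := Nat.ceil_lt_add_one hll
    push_cast
    nlinarith

/-- spanning clan embedding of a weighted graph into a tree with
multiplicative distortion `O(k·log log μ(V))` and weighted clan size `≤ μ(V)^{1+1/k}`. -/
theorem spanning_clan_embedding_measure :
    ∃ C : ℝ, 0 < C ∧
      ∀ (V : Type) [Fintype V], ∀ (G : SimpleGraph V) (wG : Sym2 V → ℝ),
        2 ≤ Fintype.card V → G.Connected → (∀ e ∈ G.edgeSet, 0 < wG e) →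
        ∀ μ : V → ℝ, (∀ v, 1 ≤ μ v) →
        ∀ k : ℕ, 1 ≤ k →
        ∃ (Y : Type) (_ : Fintype Y) (T : SimpleGraph Y) (wT : Sym2 Y → ℝ)
          (f : V → Finset Y) (χ : V → Y),
          IsSpanningClanTree G wG T wT f χ
            (C * (k : ℝ) * (1 + Real.logb 2 (Real.logb 2 (∑ v, μ v)))) ∧
          ∑ v, μ v * ((f v).card : ℝ) ≤ (∑ v, μ v) ^ (1 + 1 / (k : ℝ)) := by
  classical
  refine ⟨1024, by norm_num, ?_⟩
  intro V _ G w hcard hG hw μ hμ k hk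
  have hM : 2 ≤ ∑ v, μ v := by
    have h1 : ∑ v : V, (1:ℝ) ≤ ∑ v, μ v := Finset.sum_le_sum (fun v _ => hμ v)
    have h2 : (2:ℝ) ≤ Fintype.card V := by exact_mod_cast hcard
    simp at h1
    linarith
  obtain ⟨L, hL, hML, hLC⟩ := dist_const k hk _ hM
  have hk' : (0:ℝ) < k := by exact_mod_cast hk
  obtain ⟨x0⟩ := hG.nonempty
  have hst : State G w w x0 {x0} :=
    { conn := hG
      pos := hw
      le := fun e _ => le_rfl
      ge := fun e he => by linarith [hw e he]
      eq := fun _ _ _ _ => rfl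
      geo := by
        refine ⟨rfl, ?_, ?_⟩
        · rintro p rfl q rfl _; simp [sp_self hw]
        · rintro p rfl q rfl h; exact absurd h (lt_irrefl _) }
  obtain ⟨c, -, -, -, hsum, hpair⟩ := main_rec (1 / (k:ℝ)) (by positivity) L hL _ hML
    (Fintype.card V) V G w w x0 {x0} μ rfl hst hμ le_rfl
  refine ⟨c.Y, c.fin, c.T, fun e => w (e.map c.pr), fun v => Finset.univ.filter (fun y => c.pr y = v),
    c.chief, ⟨c.tree, c.wpos hw, ?_, ?_, ?_, ?_, ?_, ?_, ?_⟩, ?_⟩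
  · intro v; exact ⟨c.chief v, by simp [c.pr_chief]⟩
  · intro u v huv
    rw [Finset.disjoint_left]
    intro y hy hy'
    simp only [Finset.mem_filter, Finset.mem_univ, true_and] at hy hy'
    exact huv (hy.symm.trans hy')
  · intro y; exact ⟨c.pr y, by simp⟩
  · intro u v u' v' hu hv hadj
    simp only [Finset.mem_filter, Finset.mem_univ, true_and] at hu hv
    subst hu hv
    exact ⟨c.hom _ _ hadj, by simp⟩
  · intro u v _ u' hu v' hv
    simp only [Finset.mem_filter, Finset.mem_univ, true_and] at hu hv
    subst hu hv
    exact sp_map c.tree.connected hG hw c.pr (fun a b hab => ⟨c.hom _ _ hab, by simp⟩) u' v'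
  · intro v; simp [c.pr_chief]
  · intro u v
    obtain ⟨y, hy, hyd⟩ := hpair u v
    refine ⟨y, by simp [hy], hyd.trans ?_⟩
    exact mul_le_mul_of_nonneg_right hLC (sp_nonneg hw u v)
  · refine le_trans (le_of_eq ?_) hsum
    rw [← Finset.sum_fiberwise (s := Finset.univ) (g := c.pr) (f := fun y => μ (c.pr y))]
    refine Finset.sum_congr rfl fun v _ => ?_
    rw [Finset.sum_congr rfl (g := fun _ => μ v) (by
      intro y hy
      simp only [Finset.mem_filter, Finset.mem_univ, true_and] at hy
      rw [hy])]
    simp [mul_comm]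
end
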